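/- arXiv:2406.16618 — 2 statements merged into one kernel-verified Lean document; each statement's English description precedes it below -/
import Mathlib

section
/- For i = 1, 2, 3, let G_i be a critical snark, e_i an edge of G_i, and w_i a vertex of G_i at distance at least 3 from both endvertices of e_i, and suppose each (2,3)-pole T_i = (G_i − e_i) − w_i is proper, perfect and good. Then the graph G = H6*TTT(T1, T2, T3) is a strictly critical snark. -/
/-- The colour set `K = (ℤ₂ × ℤ₂) ∖ {(0,0)}`. -/
abbrev Kol : Type := {x : ZMod 2 × ZMod 2 // x ≠ 0}

/-- A proper edge colouring: distinct edges sharing a vertex get distinct colours. -/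
def IsProperEdgeColoring {V C : Type*} (G : SimpleGraph V) (f : Sym2 V → C) : Prop :=
  ∀ e₁ ∈ G.edgeSet, ∀ e₂ ∈ G.edgeSet, e₁ ≠ e₂ → (∃ v : V, v ∈ e₁ ∧ v ∈ e₂) → f e₁ ≠ f e₂

/-- A graph is 3-edge-colourable if it has a proper edge colouring with three colours. -/
def ThreeEdgeColorable {V : Type*} (G : SimpleGraph V) : Prop :=
  ∃ f : Sym2 V → Kol, IsProperEdgeColoring G f

/-- A graph is cubic if every vertex has degree 3. -/
def IsCubic {V : Type*} (G : SimpleGraph V) : Prop :=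
  ∀ v : V, (G.neighborSet v).ncard = 3

/-- A snark: a connected cubic simple graph which is not 3-edge-colourable. -/
def IsSnark {V : Type*} (G : SimpleGraph V) : Prop :=
  G.Connected ∧ IsCubic G ∧ ¬ ThreeEdgeColorable G

/-- A snark is critical if removing any two distinct adjacent vertices yields a
3-edge-colourable graph. -/
def Critical {V : Type*} (G : SimpleGraph V) : Prop :=
  ∀ u v : V, G.Adj u v → ThreeEdgeColorable (G.induce ({u, v}ᶜ : Set V))

/-- A snark is bicritical if removing any two distinct vertices yields a
3-edge-colourable graph. -/
def Bicritical {V : Type*} (G : SimpleGraph V) : Prop :=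
  ∀ u v : V, u ≠ v → ThreeEdgeColorable (G.induce ({u, v}ᶜ : Set V))

/-- Strictly critical: critical but not bicritical. -/
def StrictlyCritical {V : Type*} (G : SimpleGraph V) : Prop :=
  Critical G ∧ ¬ Bicritical G

/-- A cubic graph is cyclically `k`-connected if no set of fewer than `k` edges
separates two cycles, i.e. there is no set `F` of fewer than `k` edges whose deletion
leaves a graph in which two connected components contain a cycle. -/
def CyclicallyConnected {V : Type*} (G : SimpleGraph V) (k : ℕ) : Prop :=
  ¬ ∃ F : Set (Sym2 V), F ⊆ G.edgeSet ∧ F.ncard < k ∧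
    ∃ a b : V, (∃ w : (G.deleteEdges F).Walk a a, w.IsCycle) ∧
               (∃ w : (G.deleteEdges F).Walk b b, w.IsCycle) ∧
               ¬ (G.deleteEdges F).Reachable a b

/-- The cyclic connectivity of a cubic graph: the largest `k` (at most the number of
edges) such that the graph is cyclically `k`-connected. -/
noncomputable def cyclicConnectivity {V : Type*} (G : SimpleGraph V) : ℕ :=
  sSup {k | k ≤ G.edgeSet.ncard ∧ CyclicallyConnected G k}

/-- At vertex `w`, the colouring `φ` assigns pairwise distinct colours to the edges of
`G` incident with `w`, excluding the edges `e` and `f`. -/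
def DistinctAtExcept {V : Type*} (G : SimpleGraph V) (φ : Sym2 V → Kol) (w : V)
    (e f : Sym2 V) : Prop :=
  ∀ g ∈ G.edgeSet, ∀ h ∈ G.edgeSet, g ≠ h → g ≠ e → g ≠ f → h ≠ e → h ≠ f →
    w ∈ g → w ∈ h → φ g ≠ φ h

/-- At vertex `w`, the colouring `φ` assigns equal colours to the edges of `G` incident
with `w`, excluding the edges `e` and `f`. -/
def EqualAtExcept {V : Type*} (G : SimpleGraph V) (φ : Sym2 V → Kol) (w : V)
    (e f : Sym2 V) : Prop :=
  ∀ g ∈ G.edgeSet, ∀ h ∈ G.edgeSet, g ≠ e → g ≠ f → h ≠ e → h ≠ f →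
    w ∈ g → w ∈ h → φ g = φ h

/-- The pair of disjoint edges `{e, f}` of `G` is essential: (a) it is non-removable,
i.e. `G` minus `e` and `f` (with the four degree-2 vertices suppressed) is
3-edge-colourable, expressed by a map on `E(G) ∖ {e, f}` which is proper at every
vertex not an endvertex of `e` or `f` and assigns equal colours to the two remaining
edges at each of the four endvertices; and (b) for each endvertex `t` of `e` or `f`
there is such a map which is proper everywhere except at `t`, where the two remaining
edges get equal colours. -/
def EssentialPair {V : Type*} (G : SimpleGraph V) (e f : Sym2 V) : Prop :=
  e ∈ G.edgeSet ∧ f ∈ G.edgeSet ∧ (∀ w : V, ¬ (w ∈ e ∧ w ∈ f)) ∧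
  (∃ φ : Sym2 V → Kol,
      (∀ w : V, w ∉ e → w ∉ f → DistinctAtExcept G φ w e f) ∧
      (∀ w : V, w ∈ e ∨ w ∈ f → EqualAtExcept G φ w e f)) ∧
  (∀ t : V, t ∈ e ∨ t ∈ f →
      ∃ φ : Sym2 V → Kol,
        (∀ w : V, w ∉ e → w ∉ f → DistinctAtExcept G φ w e f) ∧
        EqualAtExcept G φ t e f ∧
        (∀ x : V, (x ∈ e ∨ x ∈ f) → x ≠ t → DistinctAtExcept G φ x e f))

/-- A `(2,3)`-pole structure on a graph `T`: `z j` are the five degree-1 tip vertices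
and `s j` the corresponding degree-3 attachment endvertices, so that the pendant edges
are `s(s j, z j)`; the first two form the 2-connector `(p1, p2)` and the last three the
3-connector `(q1, q2, q3)`. The pole is proper if for every proper 3-edge-colouring
`f` with colours in `K` we have `f p1 + f p2 ≠ 0` and `f q1 + f q2 + f q3 ≠ 0`. -/
def ProperPole {V : Type*} (T : SimpleGraph V) (z s : Fin 5 → V) : Prop :=
  ∀ f : Sym2 V → Kol, IsProperEdgeColoring T f →
    ((f s(s 0, z 0) : ZMod 2 × ZMod 2) + (f s(s 1, z 1) : ZMod 2 × ZMod 2) ≠ 0 ∧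
     (f s(s 2, z 2) : ZMod 2 × ZMod 2) + (f s(s 3, z 3) : ZMod 2 × ZMod 2)
        + (f s(s 4, z 4) : ZMod 2 × ZMod 2) ≠ 0)

/-- A `(2,3)`-pole is perfect if every tuple `(α 0, …, α 4)` of colours with
`α 0 ≠ α 1`, `α 2 + α 3 + α 4 ≠ 0` and each of the three colours occurring an odd
number of times is realised on the pendant edges by some proper 3-edge-colouring. -/
def PerfectPole {V : Type*} (T : SimpleGraph V) (z s : Fin 5 → V) : Prop :=
  ∀ α : Fin 5 → Kol, α 0 ≠ α 1 →
    (α 2 : ZMod 2 × ZMod 2) + (α 3 : ZMod 2 × ZMod 2) + (α 4 : ZMod 2 × ZMod 2) ≠ 0 →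
    (∀ c : Kol, Odd ({j : Fin 5 | α j = c}.ncard)) →
    ∃ f : Sym2 V → Kol, IsProperEdgeColoring T f ∧ ∀ j : Fin 5, f s(s j, z j) = α j

/-- The graph `H6*TTT(T1, T2, T3)`: delete the five tip vertices of each pole `T i`,
add six new vertices `u_1, …, u_6` (encoded `Sum.inr (Sum.inl m)`) forming a 6-cycle,
three new vertices `v_1, v_2, v_3` (encoded `Sum.inr (Sum.inr j)`), the edges
`s_i^1 u_i`, `s_i^2 u_{i+3}` and the edges `t_i^j v_j`.  (The tips of the poles remain
as isolated vertices of this auxiliary graph and are removed afterwards by `induce`.) -/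
def glueTTT (V : Fin 3 → Type) (T : ∀ i, SimpleGraph (V i)) (z s : ∀ i, Fin 5 → V i) :
    SimpleGraph ((Σ i, V i) ⊕ (Fin 6 ⊕ Fin 3)) :=
  SimpleGraph.fromRel (fun p q =>
    (∃ (i : Fin 3) (a b : V i), p = Sum.inl ⟨i, a⟩ ∧ q = Sum.inl ⟨i, b⟩ ∧ (T i).Adj a b ∧
        (∀ j, a ≠ z i j) ∧ (∀ j, b ≠ z i j)) ∨
    (∃ m : Fin 6, p = Sum.inr (Sum.inl m) ∧ q = Sum.inr (Sum.inl (m + 1))) ∨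
    (∃ i : Fin 3, p = Sum.inl ⟨i, s i 0⟩ ∧
        q = Sum.inr (Sum.inl ⟨i.val, by have := i.isLt; omega⟩)) ∨
    (∃ i : Fin 3, p = Sum.inl ⟨i, s i 1⟩ ∧
        q = Sum.inr (Sum.inl ⟨i.val + 3, by have := i.isLt; omega⟩)) ∨
    (∃ i j : Fin 3, p = Sum.inl ⟨i, s i ⟨j.val + 2, by have := j.isLt; omega⟩⟩ ∧
        q = Sum.inr (Sum.inr j)))

/-- The vertex set of `H6*TTT(T1, T2, T3)`: everything except the tips of the poles. -/
def glueTTTSet (V : Fin 3 → Type) (z : ∀ i, Fin 5 → V i) :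
    Set ((Σ i, V i) ⊕ (Fin 6 ⊕ Fin 3)) :=
  {w | ∀ (i : Fin 3) (j : Fin 5), w ≠ Sum.inl ⟨i, z i j⟩}

/-- The vertex `v_j` of `H6*TTT(T1, T2, T3)`. -/
def glueVVertex (V : Fin 3 → Type) (z : ∀ i, Fin 5 → V i) (j : Fin 3) :
    glueTTTSet V z :=
  ⟨Sum.inr (Sum.inr j), fun _ _ => Sum.inr_ne_inl⟩

/-- The `(2,3)`-pole `(G − e) − w` obtained from a snark `G` by deleting the edge
`e = x1x2` and the vertex `w` (whose neighbours are `n 0, n 1, n 2`) and attaching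
pendant edges `p1` at `x1`, `p2` at `x2` and `q1, q2, q3` at `n 0, n 1, n 2`; the five
new degree-1 tip vertices are `Sum.inr 0, …, Sum.inr 4`.  (The deleted vertex `w`
remains as an isolated vertex `Sum.inl w`.) -/
def poleFromSnark {U : Type*} (G : SimpleGraph U) (x1 x2 w : U) (n : Fin 3 → U) :
    SimpleGraph (U ⊕ Fin 5) :=
  SimpleGraph.fromRel (fun p q =>
    (∃ a b : U, p = Sum.inl a ∧ q = Sum.inl b ∧ G.Adj a b ∧ s(a, b) ≠ s(x1, x2) ∧
        a ≠ w ∧ b ≠ w) ∨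
    (p = Sum.inl x1 ∧ q = Sum.inr 0) ∨ (p = Sum.inl x2 ∧ q = Sum.inr 1) ∨
    (p = Sum.inl (n 0) ∧ q = Sum.inr 2) ∨ (p = Sum.inl (n 1) ∧ q = Sum.inr 3) ∨
    (p = Sum.inl (n 2) ∧ q = Sum.inr 4))

/-- The tips of `poleFromSnark`. -/
def poleTips (U : Type*) : Fin 5 → U ⊕ Fin 5 := fun j => Sum.inr j

/-- The attachment endvertices of the pendant edges of `poleFromSnark`. -/
def poleAttach {U : Type*} (x1 x2 : U) (n : Fin 3 → U) : Fin 5 → U ⊕ Fin 5 :=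
  ![Sum.inl x1, Sum.inl x2, Sum.inl (n 0), Sum.inl (n 1), Sum.inl (n 2)]

/-- The pole `(G − e) − w` (with `e = x1x2`) is good: for every endvertex `x` of `e`,
every edge `g` incident with `x` and every edge `h` incident with `w`, the pair
`{g, h}` is essential in `G`. -/
def GoodPoleFrom {U : Type*} (G : SimpleGraph U) (x1 x2 w : U) : Prop :=
  ∀ x ∈ ({x1, x2} : Set U), ∀ g ∈ G.edgeSet, x ∈ g → ∀ h ∈ G.edgeSet, w ∈ h →
    EssentialPair G g h

instance : DecidableEq Kol := inferInstance

instance : Fintype Kol := inferInstance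

/-- The cyclic permutation `(1,0) ↦ (0,1) ↦ (1,1) ↦ (1,0)` of the colours. -/
def Kol.rot (x : Kol) : Kol :=
  ⟨(x.1.2, x.1.1 + x.1.2), by revert x; decide⟩

theorem Kol.sum_eq_zero_of_ne (a b c : Kol) (hab : a ≠ b) (hac : a ≠ c) (hbc : b ≠ c) :
    (a : ZMod 2 × ZMod 2) + b + c = 0 := by
  revert a b c; decide

/-- The index of the hexagon vertex joined to the first end of the `i`-th deleted edge. -/
def hexLo (i : Fin 3) : Fin 6 := ⟨i.val, by have := i.isLt; omega⟩

/-- The index of the hexagon vertex joined to the second end of the `i`-th deleted edge. -/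
def hexHi (i : Fin 3) : Fin 6 := ⟨i.val + 3, by have := i.isLt; omega⟩

/-- The three colours at the `m`-th hexagon vertex are distinct, where `c m` is the colour of the
cycle edge from `m` to `m + 1` and `d m` the colour of the third edge at `m`. -/
def HexProperAt (c d : Fin 6 → Kol) (m : Fin 6) : Prop :=
  c m ≠ c (m - 1) ∧ c m ≠ d m ∧ c (m - 1) ≠ d m

instance (c d : Fin 6 → Kol) (m : Fin 6) : Decidable (HexProperAt c d m) :=
  inferInstanceAs (Decidable (_ ∧ _))

theorem hexagon_opposite_eq (c d : Fin 6 → Kol) (h : ∀ m, HexProperAt c d m) :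
    ∃ i : Fin 3, d (hexLo i) = d (hexHi i) := by
  have hd : ∀ a b x : Kol, a ≠ b → a ≠ x → b ≠ x → x.1 = a.1 + b.1 := by decide
  have key : ∀ a b c d e f : Kol, a ≠ b → b ≠ c → c ≠ d → d ≠ e → e ≠ f → f ≠ a →
      a.1 + f.1 = d.1 + c.1 ∨ b.1 + a.1 = e.1 + d.1 ∨ c.1 + b.1 = f.1 + e.1 := by decide
  have h' := fun m => hd _ _ _ (h m).1 (h m).2.1 (h m).2.2
  have hne := fun m => (h m).1.symm
  rcases key (c 0) (c 1) (c 2) (c 3) (c 4) (c 5) (hne 1) (hne 2) (hne 3) (hne 4) (hne 5) (hne 0)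
    with k | k | k
  · exact ⟨0, Subtype.ext ((h' 0).trans (k.trans (h' 3).symm))⟩
  · exact ⟨1, Subtype.ext ((h' 1).trans (k.trans (h' 4).symm))⟩
  · exact ⟨2, Subtype.ext ((h' 2).trans (k.trans (h' 5).symm))⟩

/-- The colours `x`, `y` of a 2-connector and `q` of a 3-connector are distinct on the former and
sum to zero. -/
def ConnectorBalanced (x y : Kol) (q : Fin 3 → Kol) : Prop :=
  x ≠ y ∧ (x : ZMod 2 × ZMod 2) + y + (q 0 + q 1 + q 2) = 0

/-- The sum of two distinct colours. -/
def Kol.add (x y : Kol) (h : x ≠ y) : Kol :=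
  ⟨x.1 + y.1, by revert x y; decide⟩

theorem balanced_of_sum {x y : Kol} {q : Fin 3 → Kol} (h : x ≠ y)
    (hq : (q 0 : ZMod 2 × ZMod 2) + q 1 + q 2 = Kol.add x y h) : ConnectorBalanced x y q := by
  refine ⟨h, ?_⟩
  rw [hq]
  exact CharTwo.add_self_eq_zero _

theorem forall_ne_fin_three {P : Fin 3 → Prop} (i₀ : Fin 3) (h1 : P (i₀ + 1)) (h2 : P (i₀ + 2)) :
    ∀ i, i ≠ i₀ → P i := by
  intro i hi
  have key : ∀ i₀ i : Fin 3, i ≠ i₀ → i = i₀ + 1 ∨ i = i₀ + 2 := by decide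
  rcases key i₀ i hi with rfl | rfl
  exacts [h1, h2]

theorem exists_fun_fin_three {α : Type*} (i₀ : Fin 3) (x y z : α) :
    ∃ f : Fin 3 → α, f i₀ = x ∧ f (i₀ + 1) = y ∧ f (i₀ + 2) = z := by
  have hi : ∀ k : Fin 3, k + 1 ≠ k ∧ k + 2 ≠ k ∧ k + 2 ≠ k + 1 := by decide
  exact ⟨fun i => if i = i₀ then x else if i = i₀ + 1 then y else z, if_pos rfl,
    (if_neg (hi i₀).1).trans (if_pos rfl), (if_neg (hi i₀).2.1).trans (if_neg (hi i₀).2.2)⟩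

theorem exists_columns (ρ : Fin 3 → Kol) (s t : Kol)
    (h : (s : ZMod 2 × ZMod 2) + t = ρ 0 + ρ 1 + ρ 2) :
    ∃ a b : Fin 3 → Kol, (∀ j, ρ j ≠ a j ∧ ρ j ≠ b j ∧ a j ≠ b j) ∧
      (a 0 : ZMod 2 × ZMod 2) + a 1 + a 2 = s ∧ (b 0 : ZMod 2 × ZMod 2) + b 1 + b 2 = t := by
  have key : ∀ x y z s t : Kol, s.1 + t.1 = x.1 + y.1 + z.1 →
      ∃ f g h : Bool,
      (bif f then x.rot else x.rot.rot).1 + (bif g then y.rot else y.rot.rot).1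
        + (bif h then z.rot else z.rot.rot).1 = s.1 ∧
      (bif f then x.rot.rot else x.rot).1 + (bif g then y.rot.rot else y.rot).1
        + (bif h then z.rot.rot else z.rot).1 = t.1 := by decide
  have hrot : ∀ (x : Kol) (f : Bool), x ≠ (bif f then x.rot else x.rot.rot) ∧
      x ≠ (bif f then x.rot.rot else x.rot) ∧
      (bif f then x.rot else x.rot.rot) ≠ (bif f then x.rot.rot else x.rot) := by decide
  obtain ⟨f, g, k, h1, h2⟩ := key _ _ _ _ _ h
  refine ⟨fun j => bif ![f, g, k] j then (ρ j).rot else (ρ j).rot.rot,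
    fun j => bif ![f, g, k] j then (ρ j).rot.rot else (ρ j).rot, fun j => hrot _ _, h1, h2⟩

theorem exists_columns_off (ρ : Fin 3 → Kol) (j₀ : Fin 3) (s : Kol) :
    ∃ a b : Fin 3 → Kol, (∀ j, j ≠ j₀ → ρ j ≠ a j ∧ ρ j ≠ b j ∧ a j ≠ b j) ∧
      (a 0 : ZMod 2 × ZMod 2) + a 1 + a 2 = s ∧ (b 0 : ZMod 2 × ZMod 2) + b 1 + b 2 = s := by
  have key : ∀ y z s : Kol, ∃ f g : Bool, ∃ a b : Kol,
      a.1 + (bif f then y.rot else y.rot.rot).1 + (bif g then z.rot else z.rot.rot).1 = s.1 ∧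
      b.1 + (bif f then y.rot.rot else y.rot).1 + (bif g then z.rot.rot else z.rot).1 = s.1 := by
    decide
  have hrot : ∀ (x : Kol) (f : Bool), x ≠ (bif f then x.rot else x.rot.rot) ∧
      x ≠ (bif f then x.rot.rot else x.rot) ∧
      (bif f then x.rot else x.rot.rot) ≠ (bif f then x.rot.rot else x.rot) := by decide
  obtain ⟨f, g, a, b, hs, ht⟩ := key (ρ (j₀ + 1)) (ρ (j₀ + 2)) s
  have hsum : ∀ u : Fin 3 → Kol, (u 0 : ZMod 2 × ZMod 2) + u 1 + u 2 =
      u j₀ + u (j₀ + 1) + u (j₀ + 2) := fun u => by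
    fin_cases j₀
    · rfl
    · exact (by abel : (u 0 : ZMod 2 × ZMod 2) + u 1 + u 2 = u 1 + u 2 + u 0)
    · exact (by abel : (u 0 : ZMod 2 × ZMod 2) + u 1 + u 2 = u 2 + u 0 + u 1)
  obtain ⟨u, hu, hu1, hu2⟩ := exists_fun_fin_three j₀ a _ _
  obtain ⟨v, hv, hv1, hv2⟩ := exists_fun_fin_three j₀ b _ _
  refine ⟨u, v, forall_ne_fin_three j₀ ?_ ?_, (hsum u).trans ?_, (hsum v).trans ?_⟩
  · rw [hu1, hv1]; exact hrot _ f
  · rw [hu2, hv2]; exact hrot _ g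
  · rw [hu, hu1, hu2, hs]
  · rw [hv, hv1, hv2, ht]

theorem exists_rows (i₀ : Fin 3) (ρ a b : Fin 3 → Kol) :
    ∃ r : Fin 3 → Fin 3 → Kol, r i₀ = ρ ∧ r (i₀ + 1) = a ∧ r (i₀ + 2) = b ∧
      ∀ j, (ρ j ≠ a j ∧ ρ j ≠ b j ∧ a j ≠ b j) → Function.Injective fun i => r i j := by
  obtain ⟨r, h0, h1, h2⟩ := exists_fun_fin_three i₀ ρ a b
  refine ⟨r, h0, h1, h2, fun j hj => ?_⟩
  subst h0 h1 h2
  have key : ∀ i₀ i : Fin 3, i = i₀ ∨ i = i₀ + 1 ∨ i = i₀ + 2 := by decide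
  obtain ⟨e1, e2, e3⟩ := hj
  intro i i' h
  change r i j = r i' j at h
  rcases key i₀ i with hk | hk | hk <;> rcases key i₀ i' with hk' | hk' | hk' <;>
    rw [hk, hk'] at h ⊢ <;> first | exact absurd h ‹_› | exact absurd h.symm ‹_›

/-- A colouring of the hexagon whose `i₀`-th pair of opposite spokes is monochromatic. -/
theorem exists_hexagon (i₀ : Fin 3) (p : Kol) :
    ∃ c d : Fin 6 → Kol, (∀ m, HexProperAt c d m) ∧ d (hexLo i₀) = p ∧ d (hexHi i₀) = p ∧
      ∃ (h1 : d (hexLo (i₀ + 1)) ≠ d (hexHi (i₀ + 1)))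
        (h2 : d (hexLo (i₀ + 2)) ≠ d (hexHi (i₀ + 2))),
        Kol.add _ _ h1 = Kol.add _ _ h2 := by
  refine ⟨fun m => ![p.rot.rot, p.rot, p.rot.rot, p.rot, p, p.rot] (m - hexLo i₀),
    fun m => ![p, p, p, p, p.rot.rot, p.rot.rot] (m - hexLo i₀), ?_⟩
  revert i₀ p
  decide

theorem exists_hexagon_colouring (i₀ : Fin 3) (p : Kol) (ρ : Fin 3 → Kol)
    (hρ : Function.Injective ρ) :
    ∃ (c d : Fin 6 → Kol) (r : Fin 3 → Fin 3 → Kol), (∀ m, HexProperAt c d m) ∧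
      d (hexLo i₀) = p ∧ d (hexHi i₀) = p ∧ r i₀ = ρ ∧ (∀ j, Function.Injective fun i => r i j) ∧
      ∀ i, i ≠ i₀ → ConnectorBalanced (d (hexLo i)) (d (hexHi i)) (r i) := by
  obtain ⟨c, d, hc, hlo, hhi, h1, h2, h12⟩ := exists_hexagon i₀ p
  obtain ⟨a, b, hab, ha, hb⟩ := exists_columns ρ (Kol.add _ _ h1) (Kol.add _ _ h2) (by
    rw [Kol.sum_eq_zero_of_ne _ _ _ (hρ.ne (by decide)) (hρ.ne (by decide)) (hρ.ne (by decide)),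
      h12, CharTwo.add_self_eq_zero])
  obtain ⟨r, h0, rfl, rfl, hr⟩ := exists_rows i₀ ρ a b
  exact ⟨c, d, r, hc, hlo, hhi, h0, fun j => hr j (hab j),
    forall_ne_fin_three i₀ (balanced_of_sum h1 ha) (balanced_of_sum h2 hb)⟩

theorem exists_hexagon_colouring_off (i₀ j₀ : Fin 3) (p : Kol) (ρ : Fin 3 → Kol) :
    ∃ (c d : Fin 6 → Kol) (r : Fin 3 → Fin 3 → Kol), (∀ m, HexProperAt c d m) ∧
      d (hexLo i₀) = p ∧ d (hexHi i₀) = p ∧ r i₀ = ρ ∧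
      (∀ j, j ≠ j₀ → Function.Injective fun i => r i j) ∧
      ∀ i, i ≠ i₀ → ConnectorBalanced (d (hexLo i)) (d (hexHi i)) (r i) := by
  obtain ⟨c, d, hc, hlo, hhi, h1, h2, h12⟩ := exists_hexagon i₀ p
  obtain ⟨a, b, hab, ha, hb⟩ := exists_columns_off ρ j₀ (Kol.add _ _ h1)
  obtain ⟨r, h0, rfl, rfl, hr⟩ := exists_rows i₀ ρ a b
  exact ⟨c, d, r, hc, hlo, hhi, h0, fun j hj => hr j (hab j hj),
    forall_ne_fin_three i₀ (balanced_of_sum h1 ha) (balanced_of_sum h2 (hb.trans (by rw [h12])))⟩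

theorem exists_hexagon_minus_vertex_colouring (i₀ : Fin 3) (m : Fin 6)
    (hm : m = hexLo i₀ ∨ m = hexHi i₀) (p : Kol) (ρ : Fin 3 → Kol)
    (hρ : (p : ZMod 2 × ZMod 2) = ρ 0 + ρ 1 + ρ 2) :
    ∃ (c d : Fin 6 → Kol) (r : Fin 3 → Fin 3 → Kol), (∀ k, k ≠ m → HexProperAt c d k) ∧
      d (m + 3) = p ∧ r i₀ = ρ ∧ (∀ j, Function.Injective fun i => r i j) ∧
      ∀ i, i ≠ i₀ → ConnectorBalanced (d (hexLo i)) (d (hexHi i)) (r i) := by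
  have key : ∀ i₀ m, (m = hexLo i₀ ∨ m = hexHi i₀) → ∀ p : Kol,
      let c := fun k => ![p, p.rot.rot, p.rot, p.rot.rot, p.rot, p] (k - m)
      let d := fun k => ![p, p.rot, p, p, p, p.rot.rot] (k - m)
      (∀ k, k ≠ m → HexProperAt c d k) ∧ d (m + 3) = p ∧
      ∃ (h1 : d (hexLo (i₀ + 1)) ≠ d (hexHi (i₀ + 1)))
        (h2 : d (hexLo (i₀ + 2)) ≠ d (hexHi (i₀ + 2))),
        (Kol.add _ _ h1).1 + (Kol.add _ _ h2).1 = p.1 := by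
    decide
  obtain ⟨hc, hd, h1, h2, h12⟩ := key i₀ m hm p
  obtain ⟨a, b, hab, ha, hb⟩ := exists_columns ρ _ _ (h12.trans hρ)
  obtain ⟨r, h0, rfl, rfl, hr⟩ := exists_rows i₀ ρ a b
  exact ⟨_, _, r, hc, hd, h0, fun j => hr j (hab j),
    forall_ne_fin_three i₀ (balanced_of_sum h1 ha) (balanced_of_sum h2 hb)⟩

theorem exists_hexagon_minus_edge_colouring (m : Fin 6) :
    ∃ (c d : Fin 6 → Kol) (r : Fin 3 → Fin 3 → Kol),
      (∀ k, k ≠ m → k ≠ m + 1 → HexProperAt c d k) ∧ (∀ j, Function.Injective fun i => r i j) ∧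
      ∀ i, ConnectorBalanced (d (hexLo i)) (d (hexHi i)) (r i) := by
  have key : ∀ (p : Kol) (m : Fin 6),
      let c := fun k => ![p, p, p.rot, p.rot.rot, p, p.rot.rot] (k - m)
      let d := fun k => ![p.rot.rot, p, p.rot.rot, p, p.rot, p.rot] (k - m)
      (∀ k, k ≠ m → k ≠ m + 1 → HexProperAt c d k) ∧
      ∃ h : ∀ i, d (hexLo i) ≠ d (hexHi i),
        ∀ i i', i ≠ i' → Kol.add _ _ (h i) ≠ Kol.add _ _ (h i') := by
    decide
  obtain ⟨hc, h, hinj⟩ := key ⟨(0, 1), by decide⟩ m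
  refine ⟨_, _, fun i _ => Kol.add _ _ (h i), hc, fun j i i' => not_imp_not.1 (hinj i i'),
    fun i => balanced_of_sum (h i) ?_⟩
  rw [CharTwo.add_self_eq_zero, zero_add]

/-- Connectors on the `3`-side of a balanced assignment may be given nonzero total colour on any
nonempty subset. -/
theorem exists_balanced_sum_ne_zero (J : Finset (Fin 3)) (hJ : J.Nonempty) :
    ∃ x y q, ConnectorBalanced x y q ∧ ∑ j ∈ J, (q j : ZMod 2 × ZMod 2) ≠ 0 := by
  have key : ∀ J : Finset (Fin 3), J.Nonempty → ∀ a : Kol,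
      (∑ j ∈ J, (![a, a, a] j : Kol).1 ≠ 0) ∨ (∑ j ∈ J, (![a, a.rot, a.rot] j : Kol).1 ≠ 0) ∨
      ∑ j ∈ J, (![a, a, a.rot] j : Kol).1 ≠ 0 := by decide
  have bal : ∀ a b : Kol, a.rot.1 + a.rot.rot.1 + (a.1 + b.1 + b.1) = 0 ∧
      b.rot.1 + b.rot.rot.1 + (a.1 + a.1 + b.1) = 0 ∧ a.rot ≠ a.rot.rot := by decide
  let a : Kol := ⟨(0, 1), by decide⟩
  rcases key J hJ a with h | h | h
  exacts [⟨_, _, _, ⟨(bal a a).2.2, (bal a a).1⟩, h⟩,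
    ⟨_, _, _, ⟨(bal a a.rot).2.2, (bal a a.rot).1⟩, h⟩,
    ⟨_, _, _, ⟨(bal a.rot a.rot).2.2, (bal a a.rot).2.1⟩, h⟩]

section Labelling

variable {V C : Type*} {X : SimpleGraph V}

theorem exists_isProperEdgeColoring_of_label (L : V → V → C)
    (hs : ∀ a b, X.Adj a b → L a b = L b a) (hi : ∀ a, Set.InjOn (L a) (X.neighborSet a)) :
    ∃ f : Sym2 V → C, IsProperEdgeColoring X f ∧ ∀ a b, X.Adj a b → f s(a, b) = L a b := by
  let f : Sym2 V → C := fun e => L e.out.1 e.out.2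
  have hf : ∀ a b, X.Adj a b → f s(a, b) = L a b := by
    intro a b hab
    have h : s((s(a, b)).out.1, (s(a, b)).out.2) = s(a, b) := Quot.out_eq _
    rcases Sym2.eq_iff.1 h with ⟨h1, h2⟩ | ⟨h1, h2⟩
    · simp only [f, h1, h2]
    · simp only [f, h1, h2, hs a b hab]
  refine ⟨f, ?_, hf⟩
  rintro e₁ he₁ e₂ he₂ hne ⟨v, ⟨a, rfl⟩, ⟨b, rfl⟩⟩ h
  rw [SimpleGraph.mem_edgeSet] at he₁ he₂
  rw [hf v a he₁, hf v b he₂] at h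
  exact hne (by rw [hi v he₁ he₂ h])

theorem IsProperEdgeColoring.injOn {f : Sym2 V → C} (hf : IsProperEdgeColoring X f) (a : V) :
    Set.InjOn (fun b => f s(a, b)) (X.neighborSet a) := by
  intro b hb b' hb' h
  by_contra hne
  exact hf s(a, b) hb s(a, b') hb' (fun h' => hne (Sym2.congr_right.1 h'))
    ⟨a, Sym2.mem_mk_left _ _, Sym2.mem_mk_left _ _⟩ h

theorem threeEdgeColorable_of_label (L : V → V → Kol)
    (hs : ∀ a b, X.Adj a b → L a b = L b a) (hi : ∀ a, Set.InjOn (L a) (X.neighborSet a)) :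
    ThreeEdgeColorable X := by
  obtain ⟨f, hf, -⟩ := exists_isProperEdgeColoring_of_label L hs hi
  exact ⟨f, hf⟩

/-- In a cubic graph, a partial assignment of three colours to half-edges which is injective at
every vertex extends to all half-edges. -/
theorem exists_label_extension (hX : IsCubic X) (μ : V → V → Kol) (D : V → V → Prop)
    (h : ∀ a, Set.InjOn (μ a) {b | X.Adj a b ∧ D a b}) :
    ∃ l : V → V → Kol, (∀ a b, X.Adj a b → D a b → l a b = μ a b) ∧
      ∀ a, Set.InjOn (l a) (X.neighborSet a) := by
  classical
  have key : ∀ a, ∃ g : V → Kol, (∀ b, X.Adj a b → D a b → g b = μ a b) ∧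
      Set.InjOn g (X.neighborSet a) := by
    intro a
    have hfin : (X.neighborSet a).Finite := Set.finite_of_ncard_ne_zero (by rw [hX a]; decide)
    have := hfin.fintype
    have hcard : Fintype.card (X.neighborSet a) = (Finset.univ : Finset Kol).card := by
      rw [← Nat.card_eq_fintype_card, Nat.card_coe_set_eq, hX a]
      decide
    obtain ⟨g, hg⟩ := Finset.exists_equiv_extend_of_card_eq hcard
      (s := {b : X.neighborSet a | D a b}) (f := fun b => μ a b) (Finset.subset_univ _) (by
        intro b hb b' hb' hbb
        exact Subtype.ext (h a ⟨b.2, by simpa using hb⟩ ⟨b'.2, by simpa using hb'⟩ hbb))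
    refine ⟨fun b => if hb : b ∈ X.neighborSet a then (g ⟨b, hb⟩ : Kol) else ⟨(0, 1), by decide⟩,
      ?_, ?_⟩
    · intro b hb hD
      exact (dif_pos hb).trans (hg ⟨b, hb⟩ (by simpa using hD))
    · intro b hb b' hb' hbb
      simp only [dif_pos hb, dif_pos hb'] at hbb
      exact congrArg Subtype.val (g.injective (Subtype.ext hbb))
  choose l hl using key
  exact ⟨l, fun a => (hl a).1, fun a => (hl a).2⟩

/-- A colouring of a cubic graph minus a set of vertices extends to a labelling of all
half-edges. -/
theorem exists_label_of_induce_compl (hX : IsCubic X) {R : Set V}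
    (hR : ThreeEdgeColorable (X.induce Rᶜ)) :
    ∃ l : V → V → Kol, (∀ a b, a ∉ R → b ∉ R → X.Adj a b → l a b = l b a) ∧
      ∀ a, Set.InjOn (l a) (X.neighborSet a) := by
  classical
  obtain ⟨f, hf⟩ := hR
  let μ : V → V → Kol := fun a b =>
    if h : a ∈ Rᶜ ∧ b ∈ Rᶜ then f s(⟨a, h.1⟩, ⟨b, h.2⟩) else ⟨(0, 1), by decide⟩
  obtain ⟨l, hl, hinj⟩ := exists_label_extension hX μ (fun a b => a ∈ Rᶜ ∧ b ∈ Rᶜ) (by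
    rintro a b ⟨hab, hD⟩ b' ⟨hab', hD'⟩ hbb
    simp only [μ, dif_pos hD, dif_pos hD'] at hbb
    exact congrArg Subtype.val (hf.injOn (⟨a, hD.1⟩ : (Rᶜ : Set V)) (x₁ := ⟨b, hD.2⟩)
      (x₂ := ⟨b', hD'.2⟩) hab hab' hbb))
  refine ⟨l, fun a b ha hb hab => ?_, hinj⟩
  rw [hl a b hab ⟨ha, hb⟩, hl b a hab.symm ⟨hb, ha⟩]
  simp only [μ, dif_pos (show a ∈ Rᶜ ∧ b ∈ Rᶜ from ⟨ha, hb⟩),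
    dif_pos (show b ∈ Rᶜ ∧ a ∈ Rᶜ from ⟨hb, ha⟩)]
  rw [Sym2.eq_swap]

/-- The parity lemma: the colours leaving a set of vertices of a cubic graph sum to zero. -/
theorem sum_boundary_eq_zero [Fintype V] [DecidableEq V] [DecidableRel X.Adj] (hX : IsCubic X)
    (l : V → V → Kol) (B : Finset V) (hi : ∀ a ∈ B, Set.InjOn (l a) (X.neighborSet a))
    (hs : ∀ a ∈ B, ∀ b ∈ B, X.Adj a b → l a b = l b a) :
    ∑ b ∈ Bᶜ, ∑ a ∈ B with X.Adj a b, (l a b : ZMod 2 × ZMod 2) = 0 := by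
  let F : V → V → ZMod 2 × ZMod 2 := fun a b => if X.Adj a b then (l a b).1 else 0
  have hvertex : ∀ a ∈ B, ∑ b, F a b = 0 := by
    intro a ha
    have hcard : (X.neighborFinset a).card = 3 := by
      rw [← hX a, ← Set.ncard_coe_finset, SimpleGraph.coe_neighborFinset]
    obtain ⟨x, y, z, hxy, hxz, hyz, hxyz⟩ := Finset.card_eq_three.1 hcard
    have hmem : ∀ b, b = x ∨ b = y ∨ b = z → b ∈ X.neighborSet a := fun b hb => by
      rw [← SimpleGraph.coe_neighborFinset, hxyz]
      simpa using hb
    have hx := hmem x (.inl rfl)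
    have hy := hmem y (.inr (.inl rfl))
    have hz := hmem z (.inr (.inr rfl))
    rw [← Finset.sum_filter, ← SimpleGraph.neighborFinset_eq_filter, hxyz,
      Finset.sum_insert (by simp [hxy, hxz]), Finset.sum_pair hyz, ← add_assoc]
    exact Kol.sum_eq_zero_of_ne _ _ _ ((hi a ha).ne hx hy hxy) ((hi a ha).ne hx hz hxz)
      ((hi a ha).ne hy hz hyz)
  have hinner : ∑ a ∈ B, ∑ b ∈ B, F a b = 0 := by
    rw [← Finset.sum_product']
    refine Finset.sum_involution (fun p _ => p.swap) ?_ ?_ ?_ ?_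
    · rintro ⟨a, b⟩ hab
      rw [Finset.mem_product] at hab
      by_cases h : X.Adj a b
      · simp only [F, Prod.fst_swap, Prod.snd_swap, if_pos h, if_pos h.symm,
          hs a hab.1 b hab.2 h]
        exact CharTwo.add_self_eq_zero _
      · simp only [F, Prod.fst_swap, Prod.snd_swap, if_neg h, if_neg (mt SimpleGraph.Adj.symm h),
          add_zero]
    · rintro ⟨a, b⟩ - h hab
      obtain rfl : b = a := congrArg Prod.fst hab
      exact h (if_neg (X.loopless.irrefl b))
    · rintro ⟨a, b⟩ hab
      simpa [and_comm] using hab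
    · rintro ⟨a, b⟩ -
      rfl
  have htotal : ∑ a ∈ B, ∑ b, F a b = 0 := Finset.sum_eq_zero hvertex
  simp_rw [← Finset.sum_add_sum_compl B, Finset.sum_add_distrib, hinner, zero_add] at htotal
  rw [Finset.sum_comm] at htotal
  simpa only [Finset.sum_filter] using htotal

end Labelling

section Pole

variable {U : Type} {G : SimpleGraph U} {x1 x2 w : U} {n : Fin 3 → U}

/-- The edge `x1 x2` and the vertex `w` with neighbours `n 0, n 1, n 2` of a cubic graph, where `w`
is neither an end of the edge nor adjacent to one. -/
structure PoleSite (G : SimpleGraph U) (x1 x2 w : U) (n : Fin 3 → U) : Prop where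
  cubic : IsCubic G
  adj : G.Adj x1 x2
  ne1 : x1 ≠ w
  ne2 : x2 ≠ w
  not_adj1 : ¬ G.Adj x1 w
  not_adj2 : ¬ G.Adj x2 w
  adj_iff : ∀ a, G.Adj a w ↔ ∃ j, a = n j
  inj : Function.Injective n

theorem PoleSite.of_dist (hsnark : IsSnark G) (hedge : G.Adj x1 x2) (hd1 : 3 ≤ G.dist w x1)
    (hd2 : 3 ≤ G.dist w x2) (hnbr : G.neighborSet w = {n 0, n 1, n 2})
    (hninj : Function.Injective n) : PoleSite G x1 x2 w n where
  cubic := hsnark.2.1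
  adj := hedge
  ne1 := by
    rintro rfl
    simp at hd1
  ne2 := by
    rintro rfl
    simp at hd2
  not_adj1 h := by
    rw [SimpleGraph.dist_eq_one_iff_adj.2 h.symm] at hd1
    omega
  not_adj2 h := by
    rw [SimpleGraph.dist_eq_one_iff_adj.2 h.symm] at hd2
    omega
  adj_iff a := by
    rw [SimpleGraph.adj_comm, ← SimpleGraph.mem_neighborSet, hnbr, Fin.exists_fin_succ,
      Fin.exists_fin_succ, Fin.exists_fin_one]
    rfl
  inj := hninj

/-- Exchanging the ends of the removed edge. -/
theorem PoleSite.swap (h : PoleSite G x1 x2 w n) : PoleSite G x2 x1 w n :=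
  ⟨h.cubic, h.adj.symm, h.ne2, h.ne1, h.not_adj2, h.not_adj1, h.adj_iff, h.inj⟩

theorem PoleSite.adj_n (h : PoleSite G x1 x2 w n) (j : Fin 3) : G.Adj (n j) w :=
  (h.adj_iff _).2 ⟨j, rfl⟩

theorem PoleSite.n_ne (h : PoleSite G x1 x2 w n) (j : Fin 3) : n j ≠ w := (h.adj_n j).ne

theorem PoleSite.ne1_n (h : PoleSite G x1 x2 w n) (j : Fin 3) : x1 ≠ n j :=
  fun he => h.not_adj1 (he ▸ h.adj_n j)

theorem PoleSite.ne2_n (h : PoleSite G x1 x2 w n) (j : Fin 3) : x2 ≠ n j := h.swap.ne1_n j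

/-- An edge leaving a vertex other than `w` becomes one of the five pendant edges or is kept. -/
theorem PoleSite.adj_cases (h : PoleSite G x1 x2 w n) {a b : U} (hab : G.Adj a b) :
    (a = x1 ∧ b = x2) ∨ (a = x2 ∧ b = x1) ∨ (∃ j, a = n j ∧ b = w) ∨
      (b ≠ w ∧ s(a, b) ≠ s(x1, x2)) := by
  by_cases hb : b = w
  · subst hb
    obtain ⟨j, hj⟩ := (h.adj_iff a).1 hab
    exact .inr (.inr (.inl ⟨j, hj, rfl⟩))
  · by_cases he : s(a, b) = s(x1, x2)
    · rcases Sym2.eq_iff.1 he with h' | h'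
      · exact .inl h'
      · exact .inr (.inl h')
    · exact .inr (.inr (.inr ⟨hb, he⟩))

/-- A proper labelling, by colours, of the half-edges of the pole `(G - x1x2) - w` with the vertices
of `R` removed. The colours of the pendant edges are `l x1 x2`, `l x2 x1` and `l (n j) w`. -/
structure PoleLabelling (G : SimpleGraph U) (x1 x2 w : U) (R : Set U) (l : U → U → Kol) :
    Prop where
  symm : ∀ a b, a ∉ R → b ∉ R → a ≠ w → b ≠ w → G.Adj a b → s(a, b) ≠ s(x1, x2) → l a b = l b a
  inj : ∀ a, a ∉ R → a ≠ w → Set.InjOn (l a) (G.neighborSet a)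

theorem PoleLabelling.mono {R R' : Set U} {l : U → U → Kol} (hl : PoleLabelling G x1 x2 w R l)
    (h : R ⊆ R') : PoleLabelling G x1 x2 w R' l :=
  ⟨fun a b ha hb => hl.symm a b (fun h' => ha (h h')) (fun h' => hb (h h')),
    fun a ha => hl.inj a (fun h' => ha (h h'))⟩

theorem PoleLabelling.swap {R : Set U} {l : U → U → Kol} (hl : PoleLabelling G x1 x2 w R l) :
    PoleLabelling G x2 x1 w R l :=
  ⟨fun a b ha hb haw hbw hab he => hl.symm a b ha hb haw hbw hab (by rwa [Sym2.eq_swap (a := x1)]),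
    hl.inj⟩

open Classical in
/-- The other end, in the pole, of the edge that leaves `a` towards `b` in the original graph. -/
noncomputable def poleEnd (x1 x2 w : U) (n : Fin 3 → U) (a b : U) : U ⊕ Fin 5 :=
  if b = w then .inr (if a = n 0 then 2 else if a = n 1 then 3 else 4)
  else if s(a, b) = s(x1, x2) then .inr (if a = x1 then 0 else 1) else .inl b

/-- The vertex of the original graph towards which an edge of the pole leads. -/
def poleBack (x1 x2 w : U) : U ⊕ Fin 5 → U := Sum.elim id ![x2, x1, w, w, w]

theorem poleEnd_one (h : PoleSite G x1 x2 w n) : poleEnd x1 x2 w n x1 x2 = .inr 0 := by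
  simp [poleEnd, h.ne2]

theorem poleEnd_two (h : PoleSite G x1 x2 w n) : poleEnd x1 x2 w n x2 x1 = .inr 1 := by
  simp [poleEnd, h.ne1, Sym2.eq_swap, h.adj.ne']

theorem poleEnd_n (h : PoleSite G x1 x2 w n) (j : Fin 3) :
    poleEnd x1 x2 w n (n j) w = .inr ⟨j.val + 2, by omega⟩ := by
  fin_cases j <;> simp [poleEnd, h.inj.eq_iff]

theorem poleEnd_inl {a b : U} (hb : b ≠ w) (he : s(a, b) ≠ s(x1, x2)) :
    poleEnd x1 x2 w n a b = .inl b := by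
  rw [poleEnd, if_neg hb, if_neg he]

theorem poleBack_poleEnd (h : PoleSite G x1 x2 w n) {a b : U} (hab : G.Adj a b) :
    poleBack x1 x2 w (poleEnd x1 x2 w n a b) = b := by
  rcases h.adj_cases hab with ⟨rfl, rfl⟩ | ⟨rfl, rfl⟩ | ⟨j, rfl, rfl⟩ | ⟨hb, he⟩
  · rw [poleEnd_one h]; rfl
  · rw [poleEnd_two h]; rfl
  · rw [poleEnd_n h]; fin_cases j <;> rfl
  · rw [poleEnd_inl hb he]; rfl

theorem poleEnd_injOn (h : PoleSite G x1 x2 w n) (a : U) :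
    Set.InjOn (poleEnd x1 x2 w n a) (G.neighborSet a) := fun b hb b' hb' hbb => by
  rw [← poleBack_poleEnd h hb, ← poleBack_poleEnd h hb', hbb]

theorem pole_adj_inl_inl {a b : U} : (poleFromSnark G x1 x2 w n).Adj (.inl a) (.inl b) ↔
    G.Adj a b ∧ s(a, b) ≠ s(x1, x2) ∧ a ≠ w ∧ b ≠ w := by
  simp only [poleFromSnark, SimpleGraph.fromRel_adj, Sum.inl.injEq, reduceCtorEq, and_false,
    or_false, ne_eq]
  constructor
  · rintro ⟨-, ⟨a', b', rfl, rfl, h⟩ | ⟨a', b', rfl, rfl, h1, h2, h3, h4⟩⟩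
    · exact h
    · exact ⟨h1.symm, by rwa [Sym2.eq_swap], h4, h3⟩
  · exact fun h => ⟨h.1.ne, .inl ⟨a, b, rfl, rfl, h⟩⟩

theorem pole_adj_inl_inr {a : U} {k : Fin 5} :
    (poleFromSnark G x1 x2 w n).Adj (.inl a) (.inr k) ↔ .inl a = poleAttach x1 x2 n k := by
  fin_cases k <;> simp [poleFromSnark, poleAttach]

theorem pole_not_adj_inr_inr {k k' : Fin 5} :
    ¬ (poleFromSnark G x1 x2 w n).Adj (.inr k) (.inr k') := by
  simp [poleFromSnark]

theorem pole_neighborSet (h : PoleSite G x1 x2 w n) {a : U} (ha : a ≠ w) :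
    (poleFromSnark G x1 x2 w n).neighborSet (.inl a) =
      poleEnd x1 x2 w n a '' G.neighborSet a := by
  ext q
  constructor
  · intro hq
    rw [SimpleGraph.mem_neighborSet] at hq
    rcases q with b | k
    · obtain ⟨hab, he, -, hb⟩ := pole_adj_inl_inl.1 hq
      exact ⟨b, hab, poleEnd_inl hb he⟩
    · rw [pole_adj_inl_inr] at hq
      fin_cases k <;> obtain rfl := Sum.inl_injective hq
      · exact ⟨x2, h.adj, poleEnd_one h⟩
      · exact ⟨x1, h.adj.symm, poleEnd_two h⟩
      · exact ⟨w, h.adj_n 0, poleEnd_n h 0⟩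
      · exact ⟨w, h.adj_n 1, poleEnd_n h 1⟩
      · exact ⟨w, h.adj_n 2, poleEnd_n h 2⟩
  · rintro ⟨b, hb, rfl⟩
    rw [SimpleGraph.mem_neighborSet]
    rcases h.adj_cases hb with ⟨rfl, rfl⟩ | ⟨rfl, rfl⟩ | ⟨j, rfl, rfl⟩ | ⟨hbw, he⟩
    · rw [poleEnd_one h, pole_adj_inl_inr]; rfl
    · rw [poleEnd_two h, pole_adj_inl_inr]; rfl
    · rw [poleEnd_n h, pole_adj_inl_inr]; fin_cases j <;> rfl
    · rw [poleEnd_inl hbw he, pole_adj_inl_inl]; exact ⟨hb, he, ha, hbw⟩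

/-- In a proper pole the two pendant edges of the 2-connector get different colours. -/
theorem PoleLabelling.ne_of_proper (h : PoleSite G x1 x2 w n)
    (hproper : ProperPole (poleFromSnark G x1 x2 w n) (poleTips U) (poleAttach x1 x2 n))
    {l : U → U → Kol} (hl : PoleLabelling G x1 x2 w ∅ l) : l x1 x2 ≠ l x2 x1 := by
  let att : Fin 5 → U := ![x1, x2, n 0, n 1, n 2]
  have hatt : ∀ {a k}, (poleFromSnark G x1 x2 w n).Adj (.inl a) (.inr k) → a = att k := by
    intro a k hak
    rw [pole_adj_inl_inr] at hak
    fin_cases k <;> exact Sum.inl_injective hak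
  let L : U ⊕ Fin 5 → U ⊕ Fin 5 → Kol := Sum.elim (fun a q => l a (poleBack x1 x2 w q))
    (fun k _ => l (att k) (poleBack x1 x2 w (.inr k)))
  obtain ⟨f, hf, hfL⟩ := exists_isProperEdgeColoring_of_label
    (X := poleFromSnark G x1 x2 w n) L (by
      rintro (a | k) (b | k') hab
      · obtain ⟨h1, h2, h3, h4⟩ := pole_adj_inl_inl.1 hab
        exact hl.symm a b (Set.notMem_empty _) (Set.notMem_empty _) h3 h4 h1 h2
      · obtain rfl := hatt hab
        rfl
      · obtain rfl := hatt hab.symm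
        rfl
      · exact absurd hab pole_not_adj_inr_inr) (by
      rintro (a | k)
      · by_cases ha : a = w
        · intro q hq
          rw [SimpleGraph.mem_neighborSet] at hq
          rcases q with b | k
          · exact absurd ha (pole_adj_inl_inl.1 hq).2.2.1
          · have := hatt hq
            rw [ha] at this
            fin_cases k
            · exact absurd this.symm h.ne1
            · exact absurd this.symm h.ne2
            · exact absurd this.symm (h.n_ne 0)
            · exact absurd this.symm (h.n_ne 1)
            · exact absurd this.symm (h.n_ne 2)
        · rw [pole_neighborSet h ha]
          rintro _ ⟨b, hb, rfl⟩ _ ⟨b', hb', rfl⟩ hbb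
          simp only [L, Sum.elim_inl, poleBack_poleEnd h hb, poleBack_poleEnd h hb'] at hbb
          rw [hl.inj a (Set.notMem_empty _) ha hb hb' hbb]
      · rintro (b | k') hb (b' | k'') hb' -
        · rw [hatt (SimpleGraph.Adj.symm hb), hatt (SimpleGraph.Adj.symm hb')]
        · exact absurd hb' pole_not_adj_inr_inr
        all_goals exact absurd hb pole_not_adj_inr_inr)
  intro heq
  refine (hproper f hf).1 ?_
  have h0 : f s(.inl x1, .inr 0) = l x1 x2 := hfL (.inl x1) (.inr 0) (pole_adj_inl_inr.2 rfl)
  have h1 : f s(.inl x2, .inr 1) = l x2 x1 := hfL (.inl x2) (.inr 1) (pole_adj_inl_inr.2 rfl)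
  change (f s(.inl x1, .inr 0) : ZMod 2 × ZMod 2) + f s(.inl x2, .inr 1) = 0
  rw [h0, h1, heq]
  exact CharTwo.add_self_eq_zero _

theorem Kol.odd_count : ∀ x y p q r c : Kol, (x : ZMod 2 × ZMod 2) + y + (p + q + r) = 0 →
    Odd ((if x = c then 1 else 0) + (if y = c then 1 else 0) + (if p = c then 1 else 0) +
      (if q = c then 1 else 0) + (if r = c then 1 else 0)) := by
  decide

theorem exists_poleLabelling_of_perfect (h : PoleSite G x1 x2 w n)
    (hperfect : PerfectPole (poleFromSnark G x1 x2 w n) (poleTips U) (poleAttach x1 x2 n))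
    {x y : Kol} {q : Fin 3 → Kol} (hq : ConnectorBalanced x y q) :
    ∃ l, PoleLabelling G x1 x2 w ∅ l ∧ l x1 x2 = x ∧ l x2 x1 = y ∧ ∀ j, l (n j) w = q j := by
  obtain ⟨f, hf, hα⟩ := hperfect ![x, y, q 0, q 1, q 2] hq.1 (by
    intro h0
    have h1 := hq.2
    change (q 0 : ZMod 2 × ZMod 2) + q 1 + q 2 = 0 at h0
    rw [h0, add_zero] at h1
    exact hq.1 (Subtype.ext (CharTwo.add_eq_zero.1 h1))) (by
    intro c
    rw [Set.ncard_eq_toFinset_card', Set.toFinset_ofPred, Finset.card_filter, Fin.sum_univ_five]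
    exact Kol.odd_count x y (q 0) (q 1) (q 2) c hq.2)
  refine ⟨fun a b => f s(.inl a, poleEnd x1 x2 w n a b), ⟨?_, ?_⟩, ?_, ?_, ?_⟩
  · intro a b _ _ ha hb _ he
    have he' : s(b, a) ≠ s(x1, x2) := by rwa [Sym2.eq_swap (a := b)]
    simp only [poleEnd_inl hb he, poleEnd_inl ha he']
    rw [Sym2.eq_swap]
  · intro a _ ha
    refine (hf.injOn (.inl a)).comp (poleEnd_injOn h a) ?_
    rw [pole_neighborSet h ha]
    exact Set.mapsTo_image _ _
  · simp only [poleEnd_one h]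
    exact hα 0
  · simp only [poleEnd_two h]
    exact hα 1
  · intro j
    simp only [poleEnd_n h]
    fin_cases j
    · exact hα 2
    · exact hα 3
    · exact hα 4

/-- A colouring of a snark minus the ends of an edge of the pole, seen in the pole. -/
theorem exists_poleLabelling_of_critical_edge (h : PoleSite G x1 x2 w n) {a b : U}
    (ha : a ≠ w) (hb : b ≠ w) (hcol : ThreeEdgeColorable (G.induce ({a, b}ᶜ : Set U))) :
    ∃ l p ρ, PoleLabelling G x1 x2 w {a, b} l ∧ Function.Injective ρ ∧
      (x1 ∉ ({a, b} : Set U) → l x1 x2 = p) ∧ (x2 ∉ ({a, b} : Set U) → l x2 x1 = p) ∧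
      ∀ j, n j ∉ ({a, b} : Set U) → l (n j) w = ρ j := by
  classical
  obtain ⟨l, hsymm, hinj⟩ := exists_label_of_induce_compl h.cubic hcol
  have hw : w ∉ ({a, b} : Set U) := by simp [ha.symm, hb.symm]
  refine ⟨l, if x1 ∈ ({a, b} : Set U) then l x2 x1 else l x1 x2, fun j => l w (n j),
    ⟨fun c d hc hd _ _ hcd _ => hsymm c d hc hd hcd, fun c _ _ => hinj c⟩, ?_, ?_, ?_, ?_⟩
  · intro j j' hj
    exact h.inj (hinj w (h.adj_n j).symm (h.adj_n j').symm hj)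
  · intro h1
    rw [if_neg h1]
  · intro h2
    split_ifs with h1
    · rfl
    · exact hsymm x2 x1 h2 h1 h.adj.symm
  · exact fun j hj => hsymm _ _ hj hw (h.adj_n j)

/-- A colouring of a snark minus `w` and one of its neighbours, seen in the pole. -/
theorem exists_poleLabelling_of_critical_spoke (h : PoleSite G x1 x2 w n) (j : Fin 3)
    (hcol : ThreeEdgeColorable (G.induce ({n j, w}ᶜ : Set U))) :
    ∃ l p, PoleLabelling G x1 x2 w {n j} l ∧ l x1 x2 = p ∧ l x2 x1 = p := by
  obtain ⟨l, hsymm, hinj⟩ := exists_label_of_induce_compl h.cubic hcol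
  have hR : ∀ {c}, c ∉ ({n j} : Set U) → c ≠ w → c ∉ ({n j, w} : Set U) := by
    rintro c h1 h2 (h3 | h3)
    exacts [h1 h3, h2 h3]
  refine ⟨l, _, ⟨fun c d hc hd hcw hdw hcd _ => hsymm c d (hR hc hcw) (hR hd hdw) hcd,
    fun c _ _ => hinj c⟩, rfl, hsymm _ _ (hR (h.ne2_n j) h.ne2) (hR (h.ne1_n j) h.ne1) h.adj.symm⟩

theorem sum_adj_w (h : PoleSite G x1 x2 w n) [Fintype U] [DecidableEq U] [DecidableRel G.Adj]
    (l : U → U → Kol) (B : Finset U) :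
    ∑ a ∈ B with G.Adj a w, (l a w : ZMod 2 × ZMod 2) =
      ∑ j with n j ∈ B, (l (n j) w : ZMod 2 × ZMod 2) := by
  have hB : B.filter (fun a => G.Adj a w) = ({j | n j ∈ B} : Finset (Fin 3)).image n := by
    ext a
    simp only [Finset.mem_filter, h.adj_iff, Finset.mem_image, Finset.mem_univ, true_and]
    constructor
    · rintro ⟨ha, j, rfl⟩
      exact ⟨j, ha, rfl⟩
    · rintro ⟨j, hj, rfl⟩
      exact ⟨hj, j, rfl⟩
  rw [hB, Finset.sum_image fun j _ j' _ hj => h.inj hj]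

/-- A colouring provided by an essential pair of edges, one of them `x1 x2` and the other incident
with `w`, which is improper at `x1`. -/
theorem exists_poleLabelling_of_essentialPair [Fintype U] (h : PoleSite G x1 x2 w n)
    (hess : EssentialPair G s(x1, x2) s(w, n 0)) :
    ∃ l, PoleLabelling G x1 x2 w {x1} l ∧
      (l x2 x1 : ZMod 2 × ZMod 2) = l (n 0) w + l (n 1) w + l (n 2) w := by
  classical
  obtain ⟨φ, hout, heq, hends⟩ := hess.2.2.2.2 x1 (.inl (Sym2.mem_mk_left _ _))
  have hdist : ∀ a, a ≠ x1 → DistinctAtExcept G φ a s(x1, x2) s(w, n 0) := by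
    intro a ha
    by_cases h' : a ∈ s(x1, x2) ∨ a ∈ s(w, n 0)
    · exact hends a h' ha
    · rw [not_or] at h'
      exact hout a h'.1 h'.2
  obtain ⟨l, hl, hinj⟩ := exists_label_extension h.cubic (fun a b => φ s(a, b))
    (fun a b => a ≠ x1 ∧ s(a, b) ≠ s(x1, x2) ∧ s(a, b) ≠ s(w, n 0)) (by
      rintro a b ⟨hab, ha, hb1, hb2⟩ b' ⟨hab', -, hb1', hb2'⟩ hbb
      by_contra hne
      exact hdist a ha s(a, b) hab s(a, b') hab' (fun h' => hne (Sym2.congr_right.1 h')) hb1 hb2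
        hb1' hb2' (Sym2.mem_mk_left _ _) (Sym2.mem_mk_left _ _) hbb)
  have hnw : ∀ {a b}, a ≠ w → b ≠ w → s(a, b) ≠ s(w, n 0) := by
    intro a b ha hb h'
    rcases Sym2.eq_iff.1 h' with h' | h'
    exacts [ha h'.1, hb h'.2]
  have hlabel : PoleLabelling G x1 x2 w {x1} l := by
    refine ⟨fun a b ha hb haw hbw hab he => ?_, fun a _ _ => hinj a⟩
    rw [hl a b hab ⟨ha, he, hnw haw hbw⟩,
      hl b a hab.symm ⟨hb, by rwa [Sym2.eq_swap (a := b)], hnw hbw haw⟩]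
    exact congrArg φ Sym2.eq_swap
  refine ⟨l, hlabel, ?_⟩
  have hmem : ∀ a, a ∈ ({w, x1} : Finset U)ᶜ ↔ a ≠ w ∧ a ≠ x1 := by simp
  have hsum := sum_boundary_eq_zero h.cubic l ({w, x1} : Finset U)ᶜ (fun a _ => hinj a) (by
    intro a ha b hb hab
    rw [hmem] at ha hb
    refine hlabel.symm a b ha.2 hb.2 ha.1 hb.1 hab fun he => ?_
    rcases Sym2.eq_iff.1 he with h' | h'
    exacts [ha.2 h'.1, hb.2 h'.2])
  have hcard : (G.neighborFinset x1 \ {x2}).card = 2 := by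
    rw [Finset.card_sdiff_of_subset (by simpa using h.adj), ← Set.ncard_coe_finset,
      SimpleGraph.coe_neighborFinset, h.cubic]
    rfl
  obtain ⟨b, c, hbc, hN⟩ := Finset.card_eq_two.1 hcard
  have hmemN : ∀ a, a = b ∨ a = c ↔ G.Adj x1 a ∧ a ≠ x2 := by
    intro a
    have := Finset.ext_iff.1 hN a
    simpa using this.symm
  have hb := (hmemN b).1 (.inl rfl)
  have hc := (hmemN c).1 (.inr rfl)
  have hfilter : ({w, x1} : Finset U)ᶜ.filter (fun a => G.Adj a x1) = {x2, b, c} := by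
    ext a
    simp only [Finset.mem_filter, hmem, Finset.mem_insert, Finset.mem_singleton, hmemN,
      G.adj_comm a x1]
    constructor
    · rintro ⟨-, ha⟩
      by_cases h' : a = x2
      exacts [.inl h', .inr ⟨ha, h'⟩]
    · rintro (rfl | ⟨ha, -⟩)
      · exact ⟨⟨h.ne2, h.adj.ne'⟩, h.adj⟩
      · exact ⟨⟨fun h' => h.not_adj1 (h' ▸ ha), ha.ne'⟩, ha⟩
  have hx : ∀ d, G.Adj x1 d ∧ d ≠ x2 → s(d, x1) ≠ s(x1, x2) ∧ s(d, x1) ≠ s(w, n 0) := by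
    rintro d ⟨hd, hd2⟩
    refine ⟨fun h' => ?_, hnw (fun h' => h.not_adj1 (h' ▸ hd)) h.ne1⟩
    rcases Sym2.eq_iff.1 h' with h' | h'
    exacts [hd.ne' h'.1, hd2 h'.1]
  have hbc' : l b x1 = l c x1 := by
    rw [hl b x1 hb.1.symm ⟨hb.1.ne', hx b hb⟩, hl c x1 hc.1.symm ⟨hc.1.ne', hx c hc⟩]
    exact heq _ hb.1.symm _ hc.1.symm (hx b hb).1 (hx b hb).2 (hx c hc).1 (hx c hc).2
      (Sym2.mem_mk_right _ _) (Sym2.mem_mk_right _ _)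
  rw [compl_compl, Finset.sum_pair h.ne1.symm, sum_adj_w h, hfilter,
    Finset.sum_insert (by simp [hb.2.symm, hc.2.symm]), Finset.sum_pair hbc, hbc',
    CharTwo.add_self_eq_zero, add_zero,
    Finset.filter_true_of_mem fun j _ => (hmem _).2 ⟨h.n_ne j, (h.ne1_n j).symm⟩,
    Fin.sum_univ_three] at hsum
  exact (CharTwo.add_eq_zero.1 hsum).symm

/-- In a perfect pole, the 3-connector cannot be separated from the 2-connector. -/
theorem n_mem_of_closed [Fintype U] (h : PoleSite G x1 x2 w n)
    (hperfect : PerfectPole (poleFromSnark G x1 x2 w n) (poleTips U) (poleAttach x1 x2 n))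
    (A : Set U) (h1 : x1 ∈ A) (h2 : x2 ∈ A)
    (hA : ∀ a b, a ∈ A → G.Adj a b → s(a, b) ≠ s(x1, x2) → a ≠ w → b ≠ w → b ∈ A) (j : Fin 3) :
    n j ∈ A := by
  classical
  by_contra hj
  let B : Finset U := {a | a ∉ A ∧ a ≠ w}
  have hmem : ∀ a, a ∈ B ↔ a ∉ A ∧ a ≠ w := by simp [B]
  obtain ⟨x, y, q, hq, hne⟩ := exists_balanced_sum_ne_zero {j | n j ∈ B}
    ⟨j, by simpa [hmem] using ⟨hj, h.n_ne j⟩⟩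
  obtain ⟨l, hl, -, -, hlq⟩ := exists_poleLabelling_of_perfect h hperfect hq
  refine hne ?_
  simp_rw [← hlq]
  rw [← sum_adj_w h]
  have he : ∀ {a b}, a ∉ A → s(a, b) ≠ s(x1, x2) := by
    intro a b ha h'
    rcases Sym2.eq_iff.1 h' with ⟨rfl, -⟩ | ⟨rfl, -⟩
    exacts [ha h1, ha h2]
  refine Eq.trans ?_ (sum_boundary_eq_zero h.cubic l B
    (fun a ha => hl.inj a (Set.notMem_empty _) ((hmem a).1 ha).2) (fun a ha b hb hab =>
      hl.symm a b (Set.notMem_empty _) (Set.notMem_empty _) ((hmem a).1 ha).2 ((hmem b).1 hb).2 hab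
        (he ((hmem a).1 ha).1)))
  symm
  refine Finset.sum_eq_single_of_mem w
    (Finset.mem_compl.2 fun h' => ((hmem w).1 h').2 rfl) fun b hb hbw => ?_
  refine Finset.sum_eq_zero fun a ha => ?_
  rw [Finset.mem_filter, hmem] at ha
  rw [Finset.mem_compl, hmem, not_and_not_right] at hb
  have hbA : b ∈ A := by
    by_contra h'
    exact hbw (hb h')
  exact absurd (hA b a hbA ha.2.symm (by rw [Sym2.eq_swap]; exact he ha.1.1) hbw ha.1.2) ha.1.1

end Pole

section Glue

variable {U : Fin 3 → Type} {G : ∀ i, SimpleGraph (U i)} {x1 x2 w : ∀ i, U i}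
  {n : ∀ i, Fin 3 → U i}

/-- The vertices of the glued graph, together with the isolated tips and removed vertices. -/
abbrev GlueVertex (U : Fin 3 → Type) : Type := (Σ i, U i ⊕ Fin 5) ⊕ (Fin 6 ⊕ Fin 3)

/-- A vertex of the `i`-th pole. -/
abbrev poleV (i : Fin 3) (a : U i) : GlueVertex U := .inl ⟨i, .inl a⟩

/-- A vertex of the hexagon. -/
abbrev hexV (U : Fin 3 → Type) (m : Fin 6) : GlueVertex U := .inr (.inl m)

/-- A vertex `v_j`. -/
abbrev starV (U : Fin 3 → Type) (j : Fin 3) : GlueVertex U := .inr (.inr j)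

/-- The graph `H6*TTT` for three poles obtained from snarks, with its isolated vertices. -/
def glued (G : ∀ i, SimpleGraph (U i)) (x1 x2 w : ∀ i, U i) (n : ∀ i, Fin 3 → U i) :
    SimpleGraph (GlueVertex U) :=
  glueTTT (fun i => U i ⊕ Fin 5)
    (fun i => poleFromSnark (G i) (x1 i) (x2 i) (w i) (n i))
    (fun i => poleTips (U i)) (fun i => poleAttach (x1 i) (x2 i) (n i))

/-- The vertices of `glued` that are neither tips nor removed vertices. -/
def gluedSet (w : ∀ i, U i) : Set (GlueVertex U) :=
  {p | (∀ (i : Fin 3) (j : Fin 5), p ≠ .inl ⟨i, .inr j⟩) ∧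
    (∀ i : Fin 3, p ≠ .inl ⟨i, .inl (w i)⟩)}

theorem hexLo_or_hexHi (m : Fin 6) : ∃ i, m = hexLo i ∨ m = hexHi i := by
  revert m; decide

theorem hexLo_ne_hexHi (i i' : Fin 3) : hexLo i ≠ hexHi i' := by
  revert i i'; decide

theorem hexLo_injective : Function.Injective hexLo := by decide

theorem hex_add_one_ne_sub_one : ∀ m : Fin 6, m + 1 ≠ m - 1 := by decide

theorem hexHi_injective : Function.Injective hexHi := by decide

theorem glued_adj_pole_pole {i : Fin 3} {a b : U i} :
    (glued G x1 x2 w n).Adj (poleV i a) (poleV i b) ↔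
      (G i).Adj a b ∧ s(a, b) ≠ s(x1 i, x2 i) ∧ a ≠ w i ∧ b ≠ w i := by
  rw [← pole_adj_inl_inl (n := n i)]
  simp only [glued, glueTTT, SimpleGraph.fromRel_adj, reduceCtorEq, and_false, or_false,
    exists_false, poleTips]
  constructor
  · rintro ⟨-, ⟨i', a', b', h1, h2, h, -⟩ | ⟨i', a', b', h1, h2, h, -⟩⟩
    · cases h1; cases h2; exact h
    · cases h1; cases h2; exact h.symm
  · intro h
    exact ⟨fun h' => h.ne (eq_of_heq (Sigma.mk.inj (Sum.inl_injective h')).2),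
      .inl ⟨i, _, _, rfl, rfl, h, fun _ => Sum.inl_ne_inr, fun _ => Sum.inl_ne_inr⟩⟩

theorem glued_adj_pole_eq {i i' : Fin 3} {a : U i} {b : U i'}
    (h : (glued G x1 x2 w n).Adj (poleV i a) (poleV i' b)) : i = i' := by
  simp only [glued, glueTTT, SimpleGraph.fromRel_adj, reduceCtorEq, and_false, or_false,
    exists_false] at h
  rcases h with ⟨-, ⟨i'', a', b', h1, h2, -⟩ | ⟨i'', a', b', h1, h2, -⟩⟩ <;>
    cases h1 <;> cases h2 <;>
    rfl

theorem glued_adj_pole_hex {i : Fin 3} {a : U i} {m : Fin 6} :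
    (glued G x1 x2 w n).Adj (poleV i a) (hexV U m) ↔
      (a = x1 i ∧ m = hexLo i) ∨ (a = x2 i ∧ m = hexHi i) := by
  simp only [glued, glueTTT, SimpleGraph.fromRel_adj, reduceCtorEq, and_false, or_false, false_and,
    exists_false, false_or, ne_eq, not_false_eq_true, true_and, Sum.inl.injEq, Sum.inr.injEq]
  constructor
  · rintro (⟨i', h1, rfl⟩ | ⟨i', h1, rfl⟩) <;> obtain ⟨rfl, h2⟩ := Sigma.mk.inj h1
    · exact .inl ⟨Sum.inl_injective (eq_of_heq h2), rfl⟩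
    · exact .inr ⟨Sum.inl_injective (eq_of_heq h2), rfl⟩
  · rintro (⟨rfl, rfl⟩ | ⟨rfl, rfl⟩)
    · exact .inl ⟨i, rfl, rfl⟩
    · exact .inr ⟨i, rfl, rfl⟩

theorem glued_adj_pole_star {i j : Fin 3} {a : U i} :
    (glued G x1 x2 w n).Adj (poleV i a) (starV U j) ↔ a = n i j := by
  have hatt : ∀ j' : Fin 3, poleAttach (x1 i) (x2 i) (n i) ⟨j'.val + 2, by omega⟩ =
      .inl (n i j') := by
    intro j'; fin_cases j' <;> rfl
  simp only [glued, glueTTT, SimpleGraph.fromRel_adj, reduceCtorEq, and_false, or_false, false_and,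
    exists_false, false_or, ne_eq, not_false_eq_true, true_and, Sum.inl.injEq, Sum.inr.injEq]
  constructor
  · rintro ⟨i', j', h1, rfl⟩
    obtain ⟨rfl, h2⟩ := Sigma.mk.inj h1
    exact Sum.inl_injective ((eq_of_heq h2).trans (hatt _))
  · rintro rfl
    exact ⟨i, j, by rw [hatt], rfl⟩

theorem glued_adj_hex_hex {m m' : Fin 6} :
    (glued G x1 x2 w n).Adj (hexV U m) (hexV U m') ↔ m' = m + 1 ∨ m' = m - 1 := by
  have key : ∀ m m' : Fin 6, (m ≠ m' ∧ (m' = m + 1 ∨ m = m' + 1)) ↔ m' = m + 1 ∨ m' = m - 1 := by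
    decide
  rw [← key]
  simp only [glued, glueTTT, SimpleGraph.fromRel_adj, reduceCtorEq, and_false, or_false, false_and,
    exists_false, false_or, ne_eq, Sum.inl.injEq, Sum.inr.injEq, ↓existsAndEq, true_and]

theorem glued_not_adj_hex_star {m : Fin 6} {j : Fin 3} :
    ¬ (glued G x1 x2 w n).Adj (hexV U m) (starV U j) := by
  simp [glued, glueTTT]

theorem glued_not_adj_star_star {j j' : Fin 3} :
    ¬ (glued G x1 x2 w n).Adj (starV U j) (starV U j') := by
  simp [glued, glueTTT]

theorem glued_not_adj_tip {i : Fin 3} {k : Fin 5} {q : GlueVertex U} :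
    ¬ (glued G x1 x2 w n).Adj (.inl ⟨i, .inr k⟩) q := by
  have hatt : ∀ i' k', poleAttach (x1 i') (x2 i') (n i') k' ≠ .inr k := by
    intro i' k'; fin_cases k' <;> exact Sum.inl_ne_inr
  have hne : ∀ i' (k' : Fin 5), (Sum.inl ⟨i, .inr k⟩ : GlueVertex U) ≠
      .inl ⟨i', poleAttach (x1 i') (x2 i') (n i') k'⟩ := by
    intro i' k' h
    obtain ⟨rfl, h2⟩ := Sigma.mk.inj (Sum.inl_injective h)
    exact hatt _ _ (eq_of_heq h2).symm
  simp only [glued, glueTTT, SimpleGraph.fromRel_adj, hne, reduceCtorEq, false_and, and_false,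
    exists_false, or_false, poleTips]
  rintro ⟨-, ⟨i', a, b, h1, -, -, h2, -⟩ | ⟨i', a, b, -, h1, -, -, h2⟩⟩ <;> cases h1 <;>
    exact h2 k rfl

theorem glued_adj_mem (hs : ∀ i, PoleSite (G i) (x1 i) (x2 i) (w i) (n i)) {p q : GlueVertex U}
    (h : (glued G x1 x2 w n).Adj p q) : p ∈ gluedSet w := by
  refine ⟨?_, ?_⟩
  · rintro i k rfl
    exact glued_not_adj_tip h
  · rintro i rfl
    rcases q with ⟨i', b | k⟩ | m | j
    · obtain rfl := glued_adj_pole_eq h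
      exact (glued_adj_pole_pole.1 h).2.2.1 rfl
    · exact glued_not_adj_tip h.symm
    · rcases glued_adj_pole_hex.1 h with ⟨h', -⟩ | ⟨h', -⟩
      exacts [(hs i).ne1 h'.symm, (hs i).ne2 h'.symm]
    · exact (hs i).n_ne j (glued_adj_pole_star.1 h).symm

theorem poleV_mem {i : Fin 3} {a : U i} : poleV i a ∈ gluedSet w ↔ a ≠ w i := by
  constructor
  · rintro h rfl
    exact h.2 i rfl
  · refine fun h => ⟨fun i' k h' => ?_, fun i' h' => ?_⟩
    · cases h'
    · obtain ⟨rfl, h2⟩ := Sigma.mk.inj (Sum.inl_injective h')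
      exact h (Sum.inl_injective (eq_of_heq h2))

theorem inr_mem {p : Fin 6 ⊕ Fin 3} : (.inr p : GlueVertex U) ∈ gluedSet w :=
  ⟨fun _ _ => Sum.inr_ne_inl, fun _ => Sum.inr_ne_inl⟩

/-- The vertex of the glued graph that stands at the end of an edge of the `i`-th pole. -/
def port (i : Fin 3) : U i ⊕ Fin 5 → GlueVertex U :=
  Sum.elim (poleV i) ![hexV U (hexLo i), hexV U (hexHi i), starV U 0, starV U 1, starV U 2]

/-- The neighbour, in the glued graph, of the vertex `a` of the `i`-th pole that corresponds to the
neighbour `b` of `a` in the original graph. -/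
noncomputable def gluedEnd (x1 x2 w : ∀ i, U i) (n : ∀ i, Fin 3 → U i) (i : Fin 3) (a b : U i) :
    GlueVertex U :=
  port i (poleEnd (x1 i) (x2 i) (w i) (n i) a b)

open Classical in
/-- The inverse of `gluedEnd`. -/
noncomputable def gluedBack (x1 x2 w : ∀ i, U i) (i : Fin 3) : GlueVertex U → U i
  | .inl ⟨i', .inl b⟩ => if h : i' = i then h ▸ b else w i
  | .inl ⟨_, .inr _⟩ => w i
  | .inr (.inl m) => if m = hexLo i then x2 i else x1 i
  | .inr (.inr _) => w i

theorem gluedEnd_inl {i : Fin 3} {a b : U i} (hb : b ≠ w i) (he : s(a, b) ≠ s(x1 i, x2 i)) :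
    gluedEnd x1 x2 w n i a b = poleV i b := by
  rw [gluedEnd, poleEnd_inl hb he]; rfl

theorem gluedBack_poleV {i : Fin 3} (b : U i) : gluedBack x1 x2 w i (poleV i b) = b := dif_pos rfl

theorem gluedBack_lo (i : Fin 3) : gluedBack x1 x2 w i (hexV U (hexLo i)) = x2 i := if_pos rfl

theorem gluedBack_hi (i : Fin 3) : gluedBack x1 x2 w i (hexV U (hexHi i)) = x1 i :=
  if_neg (hexLo_ne_hexHi i i).symm

section Ends

variable (hs : ∀ i, PoleSite (G i) (x1 i) (x2 i) (w i) (n i))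
include hs

theorem gluedEnd_one (i : Fin 3) : gluedEnd x1 x2 w n i (x1 i) (x2 i) = hexV U (hexLo i) := by
  rw [gluedEnd, poleEnd_one (hs i)]; rfl

theorem gluedEnd_two (i : Fin 3) : gluedEnd x1 x2 w n i (x2 i) (x1 i) = hexV U (hexHi i) := by
  rw [gluedEnd, poleEnd_two (hs i)]; rfl

theorem gluedEnd_n (i j : Fin 3) : gluedEnd x1 x2 w n i (n i j) (w i) = starV U j := by
  rw [gluedEnd, poleEnd_n (hs i)]; fin_cases j <;> rfl

theorem gluedBack_gluedEnd {i : Fin 3} {a b : U i} (hab : (G i).Adj a b) :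
    gluedBack x1 x2 w i (gluedEnd x1 x2 w n i a b) = b := by
  rcases (hs i).adj_cases hab with ⟨rfl, rfl⟩ | ⟨rfl, rfl⟩ | ⟨j, rfl, rfl⟩ | ⟨hb, he⟩
  · rw [gluedEnd_one hs, gluedBack_lo]
  · rw [gluedEnd_two hs, gluedBack_hi]
  · rw [gluedEnd_n hs]; rfl
  · rw [gluedEnd_inl hb he, gluedBack_poleV]

theorem gluedEnd_injOn (i : Fin 3) (a : U i) :
    Set.InjOn (gluedEnd x1 x2 w n i a) ((G i).neighborSet a) := fun b hb b' hb' hbb => by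
  rw [← gluedBack_gluedEnd hs hb, ← gluedBack_gluedEnd hs hb', hbb]

theorem glued_neighborSet_pole {i : Fin 3} {a : U i} (ha : a ≠ w i) :
    (glued G x1 x2 w n).neighborSet (poleV i a) =
      gluedEnd x1 x2 w n i a '' (G i).neighborSet a := by
  ext q
  constructor
  · intro hq
    rw [SimpleGraph.mem_neighborSet] at hq
    rcases q with ⟨i', b | k⟩ | m | j
    · obtain rfl := glued_adj_pole_eq hq
      obtain ⟨hab, he, -, hb⟩ := glued_adj_pole_pole.1 hq
      exact ⟨b, hab, gluedEnd_inl hb he⟩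
    · exact absurd hq.symm glued_not_adj_tip
    · rcases glued_adj_pole_hex.1 hq with ⟨rfl, rfl⟩ | ⟨rfl, rfl⟩
      · exact ⟨x2 i, (hs i).adj, gluedEnd_one hs i⟩
      · exact ⟨x1 i, (hs i).adj.symm, gluedEnd_two hs i⟩
    · obtain rfl := glued_adj_pole_star.1 hq
      exact ⟨w i, (hs i).adj_n j, gluedEnd_n hs i j⟩
  · rintro ⟨b, hb, rfl⟩
    rw [SimpleGraph.mem_neighborSet]
    rcases (hs i).adj_cases hb with ⟨rfl, rfl⟩ | ⟨rfl, rfl⟩ | ⟨j, rfl, rfl⟩ | ⟨hbw, he⟩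
    · rw [gluedEnd_one hs, glued_adj_pole_hex]; exact .inl ⟨rfl, rfl⟩
    · rw [gluedEnd_two hs, glued_adj_pole_hex]; exact .inr ⟨rfl, rfl⟩
    · rw [gluedEnd_n hs, glued_adj_pole_star]
    · rw [gluedEnd_inl hbw he, glued_adj_pole_pole]; exact ⟨hb, he, ha, hbw⟩

end Ends

theorem glued_neighborSet_star (j : Fin 3) :
    (glued G x1 x2 w n).neighborSet (starV U j) = Set.range fun i => poleV i (n i j) := by
  ext q
  rw [SimpleGraph.mem_neighborSet, SimpleGraph.adj_comm]
  rcases q with ⟨i, b | k⟩ | m | j'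
  · rw [glued_adj_pole_star]
    constructor
    · rintro rfl
      exact ⟨i, rfl⟩
    · rintro ⟨i', h⟩
      obtain ⟨rfl, h2⟩ := Sigma.mk.inj (Sum.inl_injective h)
      exact (Sum.inl_injective (eq_of_heq h2)).symm
  · simp [glued_not_adj_tip]
  · simp [glued_not_adj_hex_star]
  · simp [glued_not_adj_star_star]

/-- The neighbour of the `m`-th hexagon vertex in a pole. -/
def hexEnd (x1 x2 : ∀ i, U i) (m : Fin 6) : GlueVertex U :=
  if m.val < 3 then poleV (Fin.ofNat 3 m.val) (x1 _) else poleV (Fin.ofNat 3 m.val) (x2 _)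

theorem hexEnd_lo (i : Fin 3) : hexEnd x1 x2 (hexLo i) = poleV i (x1 i) := by
  fin_cases i <;> rfl

theorem hexEnd_hi (i : Fin 3) : hexEnd x1 x2 (hexHi i) = poleV i (x2 i) := by
  fin_cases i <;> rfl

theorem inr_ne_hexEnd {p : Fin 6 ⊕ Fin 3} {m : Fin 6} :
    (.inr p : GlueVertex U) ≠ hexEnd x1 x2 m := by
  unfold hexEnd
  split_ifs <;> exact Sum.inr_ne_inl

theorem glued_neighborSet_hex (m : Fin 6) :
    (glued G x1 x2 w n).neighborSet (hexV U m) =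
      {hexV U (m + 1), hexV U (m - 1), hexEnd x1 x2 m} := by
  ext q
  rw [SimpleGraph.mem_neighborSet, Set.mem_insert_iff, Set.mem_insert_iff, Set.mem_singleton_iff]
  rcases q with ⟨i, b | k⟩ | m' | j'
  · rw [SimpleGraph.adj_comm, glued_adj_pole_hex]
    simp only [reduceCtorEq, false_or]
    obtain ⟨i', rfl | rfl⟩ := hexLo_or_hexHi m
    · simp only [hexEnd_lo, (hexLo_ne_hexHi _ _), and_false, or_false, hexLo_injective.eq_iff]
      constructor
      · rintro ⟨rfl, rfl⟩; rfl
      · intro h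
        obtain ⟨rfl, h2⟩ := Sigma.mk.inj (Sum.inl_injective h)
        exact ⟨Sum.inl_injective (eq_of_heq h2), rfl⟩
    · simp only [hexEnd_hi, (hexLo_ne_hexHi _ _).symm, and_false, false_or, hexHi_injective.eq_iff]
      constructor
      · rintro ⟨rfl, rfl⟩; rfl
      · intro h
        obtain ⟨rfl, h2⟩ := Sigma.mk.inj (Sum.inl_injective h)
        exact ⟨Sum.inl_injective (eq_of_heq h2), rfl⟩
  · have : (Sum.inl ⟨i, .inr k⟩ : GlueVertex U) ≠ hexEnd x1 x2 m := by
      unfold hexEnd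
      split_ifs <;> intro h <;> cases h
    simp [SimpleGraph.adj_comm, glued_not_adj_tip, this]
  · rw [glued_adj_hex_hex]
    simp [inr_ne_hexEnd]
  · simp [glued_not_adj_hex_star, inr_ne_hexEnd]

/-- The graph `H6*TTT` for three poles obtained from snarks. -/
abbrev gluedGraph (G : ∀ i, SimpleGraph (U i)) (x1 x2 w : ∀ i, U i) (n : ∀ i, Fin 3 → U i) :
    SimpleGraph (gluedSet w) :=
  (glued G x1 x2 w n).induce (gluedSet w)

theorem gluedSet_cases {p : GlueVertex U} (hp : p ∈ gluedSet w) :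
    (∃ i a, a ≠ w i ∧ p = poleV i a) ∨ (∃ m, p = hexV U m) ∨ ∃ j, p = starV U j := by
  rcases p with ⟨i, a | k⟩ | m | j
  · exact .inl ⟨i, a, poleV_mem.1 hp, rfl⟩
  · exact absurd rfl (hp.1 i k)
  · exact .inr (.inl ⟨m, rfl⟩)
  · exact .inr (.inr ⟨j, rfl⟩)

theorem gluedGraph_cubic (hs : ∀ i, PoleSite (G i) (x1 i) (x2 i) (w i) (n i)) :
    IsCubic (gluedGraph G x1 x2 w n) := by
  rintro ⟨p, hp⟩
  have himage : Subtype.val '' (gluedGraph G x1 x2 w n).neighborSet ⟨p, hp⟩ =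
      (glued G x1 x2 w n).neighborSet p := by
    ext q
    constructor
    · rintro ⟨q, hq, rfl⟩
      exact hq
    · intro hq
      exact ⟨⟨q, glued_adj_mem hs hq.symm⟩, hq, rfl⟩
  rw [← Set.ncard_image_of_injective _ Subtype.val_injective, himage]
  rcases gluedSet_cases hp with ⟨i, a, ha, rfl⟩ | ⟨m, rfl⟩ | ⟨j, rfl⟩
  · rw [glued_neighborSet_pole hs ha, Set.InjOn.ncard_image (gluedEnd_injOn hs i a), (hs i).cubic]
  · rw [glued_neighborSet_hex, Set.ncard_eq_three]
    exact ⟨_, _, _, fun h => hex_add_one_ne_sub_one m (Sum.inl_injective (Sum.inr_injective h)),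
      inr_ne_hexEnd, inr_ne_hexEnd, rfl⟩
  · rw [glued_neighborSet_star, ← Set.image_univ, Set.ncard_image_of_injective, Set.ncard_univ,
      Nat.card_fin]
    intro i i' h
    exact congrArg Sigma.fst (Sum.inl_injective h)

end Glue

section Colouring

variable {U : Fin 3 → Type} {G : ∀ i, SimpleGraph (U i)} {x1 x2 w : ∀ i, U i}
  {n : ∀ i, Fin 3 → U i}

/-- A labelling of the half-edges of the glued graph built from labellings of its parts. -/
noncomputable def gluedLabel (x1 x2 w : ∀ i, U i) (l : ∀ i, U i → U i → Kol) (c d : Fin 6 → Kol)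
    (r : Fin 3 → Fin 3 → Kol) : GlueVertex U → GlueVertex U → Kol
  | .inl ⟨i, .inl a⟩, q => l i a (gluedBack x1 x2 w i q)
  | .inl ⟨_, .inr _⟩, _ => c 0
  | .inr (.inl m), .inr (.inl m') => if m' = m + 1 then c m else c m'
  | .inr (.inl m), _ => d m
  | .inr (.inr j), .inl ⟨i, _⟩ => r i j
  | .inr (.inr _), .inr _ => c 0

/-- Labellings of the parts of the glued graph that agree on the connecting edges give a colouring
of the glued graph with two vertices removed. -/
theorem gluedGraph_minus_colourable (hs : ∀ i, PoleSite (G i) (x1 i) (x2 i) (w i) (n i))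
    (u v : gluedSet w) (c d : Fin 6 → Kol) (r : Fin 3 → Fin 3 → Kol)
    (hc : ∀ m, hexV U m ∉ ({u.1, v.1} : Set (GlueVertex U)) → HexProperAt c d m)
    (hr : ∀ j, starV U j ∉ ({u.1, v.1} : Set (GlueVertex U)) → Function.Injective fun i => r i j)
    (hl : ∀ i, ∃ l, PoleLabelling (G i) (x1 i) (x2 i) (w i)
        {a | poleV i a ∈ ({u.1, v.1} : Set (GlueVertex U))} l ∧
      (poleV i (x1 i) ∉ ({u.1, v.1} : Set (GlueVertex U)) →
        hexV U (hexLo i) ∉ ({u.1, v.1} : Set (GlueVertex U)) → l (x1 i) (x2 i) = d (hexLo i)) ∧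
      (poleV i (x2 i) ∉ ({u.1, v.1} : Set (GlueVertex U)) →
        hexV U (hexHi i) ∉ ({u.1, v.1} : Set (GlueVertex U)) → l (x2 i) (x1 i) = d (hexHi i)) ∧
      ∀ j, poleV i (n i j) ∉ ({u.1, v.1} : Set (GlueVertex U)) →
        starV U j ∉ ({u.1, v.1} : Set (GlueVertex U)) → l (n i j) (w i) = r i j) :
    ThreeEdgeColorable ((gluedGraph G x1 x2 w n).induce ({u, v}ᶜ : Set (gluedSet w))) := by
  choose l hl h1 h2 hn using hl
  set R : Set (GlueVertex U) := {u.1, v.1} with hR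
  have hnot : ∀ p : ({u, v}ᶜ : Set (gluedSet w)), p.1.1 ∉ R := by
    rintro ⟨p, hp⟩ (h | h)
    exacts [hp (.inl (Subtype.ext h)), hp (.inr (Subtype.ext h))]
  let L := gluedLabel x1 x2 w l c d r
  have hhex : ∀ m m' : Fin 6, (m' = m + 1 ∨ m' = m - 1) →
      (if m' = m + 1 then c m else c m') = if m = m' + 1 then c m' else c m := by
    have key : ∀ m m' : Fin 6, (m' = m + 1 ∨ m' = m - 1) →
      (m' = m + 1 ∧ m ≠ m' + 1) ∨ (m' ≠ m + 1 ∧ m = m' + 1) := by decide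
    intro m m' hm
    rcases key m m' hm with ⟨h, h'⟩ | ⟨h, h'⟩
    · rw [if_pos h, if_neg h']
    · rw [if_neg h, if_pos h']
  have hpole : ∀ i (a : U i) p, poleV i a ∉ R → p ∉ R → (glued G x1 x2 w n).Adj (poleV i a) p →
      L (poleV i a) p = L p (poleV i a) := by
    intro i a p ha hp hap
    rcases p with ⟨i', b | k⟩ | m | j
    · obtain rfl := glued_adj_pole_eq hap
      obtain ⟨hab, he, haw, hbw⟩ := glued_adj_pole_pole.1 hap
      simpa only [L, gluedLabel, gluedBack_poleV] using
        (hl i).symm a b ha hp haw hbw hab he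
    · exact absurd hap.symm glued_not_adj_tip
    · rcases glued_adj_pole_hex.1 hap with ⟨rfl, rfl⟩ | ⟨rfl, rfl⟩
      · simpa only [L, gluedLabel, gluedBack_lo] using h1 i ha hp
      · simpa only [L, gluedLabel, gluedBack_hi] using h2 i ha hp
    · obtain rfl := glued_adj_pole_star.1 hap
      exact hn i j ha hp
  refine threeEdgeColorable_of_label (fun p q => L p.1.1 q.1.1) ?_ ?_
  · rintro ⟨⟨p, hpS⟩, hp⟩ ⟨⟨q, hqS⟩, hq⟩ hpq
    have hp' := hnot ⟨⟨p, hpS⟩, hp⟩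
    have hq' := hnot ⟨⟨q, hqS⟩, hq⟩
    change (glued G x1 x2 w n).Adj p q at hpq
    change L p q = L q p
    change p ∉ R at hp'
    change q ∉ R at hq'
    clear hp hq
    rcases gluedSet_cases hpS with ⟨i, a, ha, rfl⟩ | ⟨m, rfl⟩ | ⟨j, rfl⟩
    · exact hpole i a q hp' hq' hpq
    all_goals rcases gluedSet_cases hqS with ⟨i', a', ha', rfl⟩ | ⟨m', rfl⟩ | ⟨j', rfl⟩
    · exact (hpole i' a' _ hq' hp' hpq.symm).symm
    · exact hhex m m' (glued_adj_hex_hex.1 hpq)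
    · exact absurd hpq glued_not_adj_hex_star
    · exact (hpole i' a' _ hq' hp' hpq.symm).symm
    · exact absurd hpq.symm glued_not_adj_hex_star
    · exact absurd hpq glued_not_adj_star_star
  · rintro ⟨⟨p, hpS⟩, hp⟩
    have hp' : p ∉ R := hnot ⟨⟨p, hpS⟩, hp⟩
    have hinj : Set.InjOn (L p) ((glued G x1 x2 w n).neighborSet p) := by
      rcases gluedSet_cases hpS with ⟨i, a, ha, rfl⟩ | ⟨m, rfl⟩ | ⟨j, rfl⟩
      · rw [glued_neighborSet_pole hs ha]
        rintro _ ⟨b, hb, rfl⟩ _ ⟨b', hb', rfl⟩ hbb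
        simp only [L, gluedLabel, gluedBack_gluedEnd hs hb, gluedBack_gluedEnd hs hb'] at hbb
        rw [(hl i).inj a hp' ha hb hb' hbb]
      · obtain ⟨hc1, hc2, hc3⟩ := hc m hp'
        have ha : L (hexV U m) (hexV U (m + 1)) = c m := if_pos rfl
        have hb : L (hexV U m) (hexV U (m - 1)) = c (m - 1) :=
          if_neg (hex_add_one_ne_sub_one m).symm
        have hd : L (hexV U m) (hexEnd x1 x2 m) = d m := by
          unfold hexEnd
          split_ifs <;> rfl
        rw [glued_neighborSet_hex]
        rintro q (rfl | rfl | rfl) q' (rfl | rfl | rfl) hqq <;> simp only [ha, hb, hd] at hqq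
        all_goals first | rfl | exact absurd hqq ‹_› | exact absurd hqq.symm ‹_›
      · rw [glued_neighborSet_star]
        rintro _ ⟨i, rfl⟩ _ ⟨i', rfl⟩ hii
        rw [hr j hp' hii]
    exact fun q hq t ht hqq => Subtype.ext (Subtype.ext (hinj hq ht hqq))

/-- Removing two of the vertices `v_j` does not make the glued graph colourable. -/
theorem gluedGraph_minus_not_colourable (hs : ∀ i, PoleSite (G i) (x1 i) (x2 i) (w i) (n i))
    (hproper : ∀ i, ProperPole (poleFromSnark (G i) (x1 i) (x2 i) (w i) (n i))
      (poleTips (U i)) (poleAttach (x1 i) (x2 i) (n i))) :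
    ¬ ThreeEdgeColorable ((gluedGraph G x1 x2 w n).induce
      ({⟨starV U 0, inr_mem⟩, ⟨starV U 1, inr_mem⟩}ᶜ : Set (gluedSet w))) := by
  classical
  intro hcol
  obtain ⟨L, hsymm, hinj⟩ := exists_label_of_induce_compl (gluedGraph_cubic hs) hcol
  have hnot : ∀ p (hp : p ∈ gluedSet w), (∀ j, p ≠ starV U j) →
      (⟨p, hp⟩ : gluedSet w) ∉
        ({⟨starV U 0, inr_mem⟩, ⟨starV U 1, inr_mem⟩} : Set (gluedSet w)) := by
    rintro p hp hne (h | h)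
    exacts [hne 0 (congrArg Subtype.val h), hne 1 (congrArg Subtype.val h)]
  let L' : GlueVertex U → GlueVertex U → Kol := fun p q =>
    if h : p ∈ gluedSet w ∧ q ∈ gluedSet w then L ⟨p, h.1⟩ ⟨q, h.2⟩ else ⟨(0, 1), by decide⟩
  have hL : ∀ p q (h : p ∈ gluedSet w ∧ q ∈ gluedSet w), L' p q = L ⟨p, h.1⟩ ⟨q, h.2⟩ :=
    fun p q h => dif_pos h
  have hsymm' : ∀ p q, (glued G x1 x2 w n).Adj p q → (∀ j, p ≠ starV U j) →
      (∀ j, q ≠ starV U j) → L' p q = L' q p := by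
    intro p q hpq hp hq
    have hpS := glued_adj_mem hs hpq
    have hqS := glued_adj_mem hs hpq.symm
    rw [hL p q ⟨hpS, hqS⟩, hL q p ⟨hqS, hpS⟩]
    exact hsymm _ _ (hnot p hpS hp) (hnot q hqS hq) hpq
  have hinj' : ∀ p, Set.InjOn (L' p) ((glued G x1 x2 w n).neighborSet p) := by
    intro p q hq q' hq' hqq
    have hpS := glued_adj_mem hs hq
    have hqS := glued_adj_mem hs (SimpleGraph.Adj.symm hq)
    have hqS' := glued_adj_mem hs (SimpleGraph.Adj.symm hq')
    rw [hL p q ⟨hpS, hqS⟩, hL p q' ⟨hpS, hqS'⟩] at hqq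
    exact congrArg Subtype.val (hinj ⟨p, hpS⟩ (x₁ := ⟨q, hqS⟩) (x₂ := ⟨q', hqS'⟩) hq hq' hqq)
  let d : Fin 6 → Kol := fun m => L' (hexV U m) (hexEnd x1 x2 m)
  obtain ⟨i, hi⟩ := hexagon_opposite_eq (fun m => L' (hexV U m) (hexV U (m + 1))) d (by
    intro m
    have hadj : ∀ m', m' = m + 1 ∨ m' = m - 1 → (glued G x1 x2 w n).Adj (hexV U m) (hexV U m') :=
      fun m' => glued_adj_hex_hex.2
    have hback : L' (hexV U (m - 1)) (hexV U (m - 1 + 1)) = L' (hexV U m) (hexV U (m - 1)) := by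
      rw [sub_add_cancel]
      exact hsymm' _ _ (hadj _ (.inr rfl)).symm (by simp) (by simp)
    have hN := glued_neighborSet_hex (G := G) (x1 := x1) (x2 := x2) (w := w) (n := n) m
    have hI := hinj' (hexV U m)
    rw [hN] at hI
    simp only [HexProperAt, hback]
    exact ⟨hI.ne (by simp) (by simp) (by simpa using hex_add_one_ne_sub_one m),
      hI.ne (by simp) (by simp) inr_ne_hexEnd, hI.ne (by simp) (by simp) inr_ne_hexEnd⟩)
  let l : U i → U i → Kol := fun a b => L' (poleV i a) (gluedEnd x1 x2 w n i a b)
  have hl : PoleLabelling (G i) (x1 i) (x2 i) (w i) ∅ l := by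
    refine ⟨fun a b _ _ ha hb hab he => ?_, fun a _ ha => ?_⟩
    · have he' : s(b, a) ≠ s(x1 i, x2 i) := by rwa [Sym2.eq_swap (a := b)]
      simp only [l, gluedEnd_inl hb he, gluedEnd_inl ha he']
      exact hsymm' _ _ (glued_adj_pole_pole.2 ⟨hab, he, ha, hb⟩) (by simp) (by simp)
    · refine (hinj' (poleV i a)).comp (gluedEnd_injOn hs i a) ?_
      rw [glued_neighborSet_pole hs ha]
      exact Set.mapsTo_image _ _
  refine hl.ne_of_proper (hs i) (hproper i) ?_
  have hlo : d (hexLo i) = l (x1 i) (x2 i) := by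
    simp only [d, l, hexEnd_lo, gluedEnd_one hs]
    exact hsymm' _ _ (glued_adj_pole_hex.2 (.inl ⟨rfl, rfl⟩)).symm (by simp) (by simp)
  have hhi : d (hexHi i) = l (x2 i) (x1 i) := by
    simp only [d, l, hexEnd_hi, gluedEnd_two hs]
    exact hsymm' _ _ (glued_adj_pole_hex.2 (.inr ⟨rfl, rfl⟩)).symm (by simp) (by simp)
  rw [← hlo, ← hhi, hi]

theorem ThreeEdgeColorable.induce {V : Type*} {X : SimpleGraph V} (h : ThreeEdgeColorable X)
    (s : Set V) : ThreeEdgeColorable (X.induce s) := by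
  obtain ⟨f, hf⟩ := h
  exact threeEdgeColorable_of_label (fun a b => f s(a.1, b.1))
    (fun a b _ => congrArg f Sym2.eq_swap)
    fun a b hb b' hb' hbb => Subtype.ext (hf.injOn a.1 hb hb' hbb)

theorem gluedGraph_connected (hs : ∀ i, PoleSite (G i) (x1 i) (x2 i) (w i) (n i))
    [∀ i, Fintype (U i)] (hconn : ∀ i, (G i).Connected)
    (hperfect : ∀ i, PerfectPole (poleFromSnark (G i) (x1 i) (x2 i) (w i) (n i))
      (poleTips (U i)) (poleAttach (x1 i) (x2 i) (n i))) :
    (gluedGraph G x1 x2 w n).Connected := by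
  let A : Set (GlueVertex U) :=
    {p | ∃ hp : p ∈ gluedSet w, (gluedGraph G x1 x2 w n).Reachable ⟨hexV U 0, inr_mem⟩ ⟨p, hp⟩}
  have hstep : ∀ {p q}, p ∈ A → (glued G x1 x2 w n).Adj p q → q ∈ A := by
    rintro p q ⟨hp, hr⟩ hpq
    refine ⟨glued_adj_mem hs hpq.symm, hr.trans (SimpleGraph.Adj.reachable ?_)⟩
    exact hpq
  have h0 : hexV U 0 ∈ A := ⟨inr_mem, SimpleGraph.Reachable.refl _⟩
  have hhex : ∀ m, hexV U m ∈ A := by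
    have key : ∀ m, hexV U m ∈ A → hexV U (m + 1) ∈ A := fun m hm =>
      hstep hm (glued_adj_hex_hex.2 (.inl rfl))
    intro m
    induction m using Fin.induction with
    | zero => exact h0
    | succ m hm =>
      rw [← Fin.coeSucc_eq_succ]
      exact key _ hm
  have hx1 : ∀ i, poleV i (x1 i) ∈ A := fun i =>
    hstep (hhex (hexLo i)) (glued_adj_pole_hex.2 (.inl ⟨rfl, rfl⟩)).symm
  have hx2 : ∀ i, poleV i (x2 i) ∈ A := fun i =>
    hstep (hhex (hexHi i)) (glued_adj_pole_hex.2 (.inr ⟨rfl, rfl⟩)).symm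
  have hkeep : ∀ i (a b : U i), poleV i a ∈ A → (G i).Adj a b → s(a, b) ≠ s(x1 i, x2 i) → a ≠ w i →
      b ≠ w i → poleV i b ∈ A := fun i a b ha hab he haw hbw =>
    hstep ha (glued_adj_pole_pole.2 ⟨hab, he, haw, hbw⟩)
  have hn : ∀ i j, poleV i (n i j) ∈ A := fun i j =>
    n_mem_of_closed (hs i) (hperfect i) {a | poleV i a ∈ A} (hx1 i) (hx2 i) (hkeep i) j
  have hpole : ∀ i (a : U i), a = w i ∨ poleV i a ∈ A := by
    intro i a
    obtain ⟨W⟩ := (hconn i).preconnected (w i) a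
    suffices ∀ {b c : U i}, (G i).Walk b c →
        (b = w i ∨ poleV i b ∈ A) → c = w i ∨ poleV i c ∈ A from
      this W (.inl rfl)
    intro b c W
    induction W with
    | nil => exact id
    | @cons a b c hab _ ih =>
      refine fun ha => ih (or_iff_not_imp_left.2 fun hbw => ?_)
      rcases eq_or_ne a (w i) with rfl | haw
      · obtain ⟨j, rfl⟩ := ((hs i).adj_iff b).1 hab.symm
        exact hn i j
      · by_cases he : s(a, b) = s(x1 i, x2 i)
        · rcases Sym2.eq_iff.1 he with ⟨-, rfl⟩ | ⟨-, rfl⟩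
          exacts [hx2 i, hx1 i]
        · exact hkeep i a b (ha.resolve_left haw) hab he haw hbw
  have hall : ∀ p ∈ gluedSet w, p ∈ A := by
    intro p hp
    rcases gluedSet_cases hp with ⟨i, a, ha, rfl⟩ | ⟨m, rfl⟩ | ⟨j, rfl⟩
    · exact (hpole i a).resolve_left ha
    · exact hhex m
    · exact hstep (hn 0 j) (glued_adj_pole_star.2 rfl)
  rw [SimpleGraph.connected_iff_exists_forall_reachable]
  exact ⟨⟨hexV U 0, inr_mem⟩, fun p => (hall p.1 p.2).2⟩

end Colouring

section Critical

variable {U : Fin 3 → Type} {G : ∀ i, SimpleGraph (U i)} {x1 x2 w : ∀ i, U i}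
  {n : ∀ i, Fin 3 → U i}
  (hs : ∀ i, PoleSite (G i) (x1 i) (x2 i) (w i) (n i))
  (hperfect : ∀ i, PerfectPole (poleFromSnark (G i) (x1 i) (x2 i) (w i) (n i))
    (poleTips (U i)) (poleAttach (x1 i) (x2 i) (n i)))
include hs hperfect

/-- In a glued graph with two vertices removed, perfect poles need only balanced connectors. -/
theorem gluedGraph_minus_colourable_of_balanced (u v : gluedSet w) (c d : Fin 6 → Kol)
    (r : Fin 3 → Fin 3 → Kol) (i₀ : Fin 3)
    (hc : ∀ m, hexV U m ∉ ({u.1, v.1} : Set (GlueVertex U)) → HexProperAt c d m)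
    (hr : ∀ j, starV U j ∉ ({u.1, v.1} : Set (GlueVertex U)) → Function.Injective fun i => r i j)
    (hbal : ∀ i, i ≠ i₀ → ConnectorBalanced (d (hexLo i)) (d (hexHi i)) (r i))
    (hl : ∃ l, PoleLabelling (G i₀) (x1 i₀) (x2 i₀) (w i₀)
        {a | poleV i₀ a ∈ ({u.1, v.1} : Set (GlueVertex U))} l ∧
      (poleV i₀ (x1 i₀) ∉ ({u.1, v.1} : Set (GlueVertex U)) →
        hexV U (hexLo i₀) ∉ ({u.1, v.1} : Set (GlueVertex U)) →
        l (x1 i₀) (x2 i₀) = d (hexLo i₀)) ∧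
      (poleV i₀ (x2 i₀) ∉ ({u.1, v.1} : Set (GlueVertex U)) →
        hexV U (hexHi i₀) ∉ ({u.1, v.1} : Set (GlueVertex U)) →
        l (x2 i₀) (x1 i₀) = d (hexHi i₀)) ∧
      ∀ j, poleV i₀ (n i₀ j) ∉ ({u.1, v.1} : Set (GlueVertex U)) →
        starV U j ∉ ({u.1, v.1} : Set (GlueVertex U)) → l (n i₀ j) (w i₀) = r i₀ j) :
    ThreeEdgeColorable ((gluedGraph G x1 x2 w n).induce ({u, v}ᶜ : Set (gluedSet w))) := by
  refine gluedGraph_minus_colourable hs u v c d r hc hr fun i => ?_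
  by_cases hi : i = i₀
  · rw [hi]
    exact hl
  · obtain ⟨l, hl, h1, h2, hq⟩ :=
      exists_poleLabelling_of_perfect (hs i) (hperfect i) (hbal i hi)
    exact ⟨l, hl.mono (Set.empty_subset _), fun _ _ => h1, fun _ _ => h2, fun j _ _ => hq j⟩

theorem gluedGraph_minus_hex_edge {m m' : Fin 6} (hm : m' = m + 1) :
    ThreeEdgeColorable ((gluedGraph G x1 x2 w n).induce
      ({⟨hexV U m, inr_mem⟩, ⟨hexV U m', inr_mem⟩}ᶜ : Set (gluedSet w))) := by
  subst hm
  obtain ⟨c, d, r, hc, hr, hbal⟩ := exists_hexagon_minus_edge_colouring m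
  refine gluedGraph_minus_colourable_of_balanced hs hperfect _ _ c d r 0 (fun k hk => ?_)
    (fun j _ => hr j) (fun i _ => hbal i) ?_
  · simp only [Set.mem_insert_iff, Set.mem_singleton_iff, Sum.inr.injEq, Sum.inl.injEq,
      not_or] at hk
    exact hc k hk.1 hk.2
  · obtain ⟨l, hl, h1, h2, hq⟩ := exists_poleLabelling_of_perfect (hs 0) (hperfect 0) (hbal 0)
    exact ⟨l, hl.mono (Set.empty_subset _), fun _ _ => h1, fun _ _ => h2, fun j _ _ => hq j⟩

theorem gluedGraph_minus_pole_edge {i : Fin 3} (hcrit : Critical (G i)) {a b : U i}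
    (hab : (G i).Adj a b) (ha : poleV i a ∈ gluedSet w) (hb : poleV i b ∈ gluedSet w) :
    ThreeEdgeColorable ((gluedGraph G x1 x2 w n).induce
      ({⟨poleV i a, ha⟩, ⟨poleV i b, hb⟩}ᶜ : Set (gluedSet w))) := by
  obtain ⟨l, p, ρ, hl, hρ, h1, h2, hn⟩ := exists_poleLabelling_of_critical_edge (hs i)
    (poleV_mem.1 ha) (poleV_mem.1 hb) (hcrit a b hab)
  obtain ⟨c, d, r, hc, hlo, hhi, hri, hr, hbal⟩ := exists_hexagon_colouring i p ρ hρ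
  have hmem : ∀ e : U i, poleV i e ∈ ({poleV i a, poleV i b} : Set (GlueVertex U)) ↔
      e ∈ ({a, b} : Set (U i)) := by
    simp
  refine gluedGraph_minus_colourable_of_balanced hs hperfect _ _ c d r i (fun k _ => hc k)
    (fun j _ => hr j) hbal ⟨l, hl.mono fun e he => (hmem e).2 he, ?_, ?_, ?_⟩
  · intro h _
    rw [hlo, h1 (mt (hmem _).2 h)]
  · intro h _
    rw [hhi, h2 (mt (hmem _).2 h)]
  · intro j h _
    rw [hri, hn j (mt (hmem _).2 h)]

theorem gluedGraph_minus_spoke {i j : Fin 3} (hcrit : Critical (G i))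
    (ha : poleV i (n i j) ∈ gluedSet w) :
    ThreeEdgeColorable ((gluedGraph G x1 x2 w n).induce
      ({⟨poleV i (n i j), ha⟩, ⟨starV U j, inr_mem⟩}ᶜ : Set (gluedSet w))) := by
  obtain ⟨l, p, hl, h1, h2⟩ := exists_poleLabelling_of_critical_spoke (hs i) j
    (hcrit _ _ ((hs i).adj_n j))
  obtain ⟨c, d, r, hc, hlo, hhi, hri, hr, hbal⟩ :=
    exists_hexagon_colouring_off i j p fun k => l (n i k) (w i)
  refine gluedGraph_minus_colourable_of_balanced hs hperfect _ _ c d r i (fun k _ => hc k)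
    (fun k hk => hr k ?_) hbal ⟨l, hl.mono ?_, fun _ _ => h1.trans hlo.symm,
      fun _ _ => h2.trans hhi.symm, fun k _ _ => (congrFun hri k).symm⟩
  · rintro rfl
    exact hk (.inr rfl)
  · rintro e rfl
    exact .inl rfl

theorem gluedGraph_minus_lo {i : Fin 3} [Fintype (U i)]
    (hess : EssentialPair (G i) s(x1 i, x2 i) s(w i, n i 0))
    (ha : poleV i (x1 i) ∈ gluedSet w) :
    ThreeEdgeColorable ((gluedGraph G x1 x2 w n).induce
      ({⟨poleV i (x1 i), ha⟩, ⟨hexV U (hexLo i), inr_mem⟩}ᶜ : Set (gluedSet w))) := by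
  obtain ⟨l, hl, hsum⟩ := exists_poleLabelling_of_essentialPair (hs i) hess
  obtain ⟨c, d, r, hc, hd, hri, hr, hbal⟩ := exists_hexagon_minus_vertex_colouring i (hexLo i)
    (.inl rfl) _ (fun k => l (n i k) (w i)) hsum
  have hopp : ∀ i, hexLo i + 3 = hexHi i := by decide
  refine gluedGraph_minus_colourable_of_balanced hs hperfect _ _ c d r i (fun k hk => hc k ?_)
    (fun k _ => hr k) hbal ⟨l, hl.mono ?_, fun h => absurd (.inl rfl) h,
      fun _ _ => by rw [← hopp, hd], fun k _ _ => (congrFun hri k).symm⟩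
  · rintro rfl
    exact hk (.inr rfl)
  · rintro e rfl
    exact .inl rfl

theorem gluedGraph_minus_hi {i : Fin 3} [Fintype (U i)]
    (hess : EssentialPair (G i) s(x2 i, x1 i) s(w i, n i 0))
    (ha : poleV i (x2 i) ∈ gluedSet w) :
    ThreeEdgeColorable ((gluedGraph G x1 x2 w n).induce
      ({⟨poleV i (x2 i), ha⟩, ⟨hexV U (hexHi i), inr_mem⟩}ᶜ : Set (gluedSet w))) := by
  obtain ⟨l, hl, hsum⟩ := exists_poleLabelling_of_essentialPair (hs i).swap hess
  obtain ⟨c, d, r, hc, hd, hri, hr, hbal⟩ := exists_hexagon_minus_vertex_colouring i (hexHi i)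
    (.inr rfl) _ (fun k => l (n i k) (w i)) hsum
  have hopp : ∀ i, hexHi i + 3 = hexLo i := by decide
  refine gluedGraph_minus_colourable_of_balanced hs hperfect _ _ c d r i (fun k hk => hc k ?_)
    (fun k _ => hr k) hbal ⟨l, hl.swap.mono ?_, fun _ _ => by rw [← hopp, hd],
      fun h => absurd (.inl rfl) h, fun k _ _ => (congrFun hri k).symm⟩
  · rintro rfl
    exact hk (.inr rfl)
  · rintro e rfl
    exact .inl rfl

theorem gluedGraph_critical [∀ i, Fintype (U i)] (hcrit : ∀ i, Critical (G i))
    (hgood : ∀ i, GoodPoleFrom (G i) (x1 i) (x2 i) (w i)) :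
    Critical (gluedGraph G x1 x2 w n) := by
  have hpole : ∀ i (a : U i) (ha : poleV i a ∈ gluedSet w) (v : gluedSet w),
      (gluedGraph G x1 x2 w n).Adj ⟨poleV i a, ha⟩ v → ThreeEdgeColorable
        ((gluedGraph G x1 x2 w n).induce ({⟨poleV i a, ha⟩, v}ᶜ : Set (gluedSet w))) := by
    rintro i a ha ⟨v, hv⟩ hav
    change (glued G x1 x2 w n).Adj (poleV i a) v at hav
    rcases gluedSet_cases hv with ⟨i', b, hb, rfl⟩ | ⟨m, rfl⟩ | ⟨j, rfl⟩
    · obtain rfl := glued_adj_pole_eq hav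
      exact gluedGraph_minus_pole_edge hs hperfect (hcrit i) (glued_adj_pole_pole.1 hav).1 ha hv
    · rcases glued_adj_pole_hex.1 hav with ⟨rfl, rfl⟩ | ⟨rfl, rfl⟩
      · exact gluedGraph_minus_lo hs hperfect (hgood i (x1 i) (.inl rfl) _ (hs i).adj
          (Sym2.mem_mk_left _ _) _ ((hs i).adj_n 0).symm (Sym2.mem_mk_left _ _)) ha
      · exact gluedGraph_minus_hi hs hperfect (hgood i (x2 i) (.inr rfl) _ (hs i).adj.symm
          (Sym2.mem_mk_left _ _) _ ((hs i).adj_n 0).symm (Sym2.mem_mk_left _ _)) ha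
    · obtain rfl := glued_adj_pole_star.1 hav
      exact gluedGraph_minus_spoke hs hperfect (hcrit i) ha
  rintro ⟨u, hu⟩ ⟨v, hv⟩ huv
  have huv' : (glued G x1 x2 w n).Adj u v := huv
  rcases gluedSet_cases hu with ⟨i, a, -, rfl⟩ | ⟨m, rfl⟩ | ⟨j, rfl⟩
  · exact hpole i a hu _ huv
  all_goals rcases gluedSet_cases hv with ⟨i', a', -, rfl⟩ | ⟨m', rfl⟩ | ⟨j', rfl⟩
  · rw [Set.pair_comm]
    exact hpole i' a' hv _ huv.symm
  · rcases glued_adj_hex_hex.1 huv' with rfl | rfl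
    · exact gluedGraph_minus_hex_edge hs hperfect rfl
    · rw [Set.pair_comm]
      exact gluedGraph_minus_hex_edge hs hperfect (sub_add_cancel m 1).symm
  · exact absurd huv' glued_not_adj_hex_star
  · rw [Set.pair_comm]
    exact hpole i' a' hv _ huv.symm
  · exact absurd huv'.symm glued_not_adj_hex_star
  · exact absurd huv' glued_not_adj_star_star

end Critical

/-- If for `i = 1, 2, 3` the `(2,3)`-pole `T_i = (G_i − e_i) − w_i`
obtained from a critical snark `G_i` (with `w_i` at distance at least 3 from both
endvertices of `e_i`) is proper, perfect and good, then `H6*TTT(T1, T2, T3)` is a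
strictly critical snark. -/
theorem glueTTT_strictlyCritical
    (U : Fin 3 → Type) [∀ i, Fintype (U i)]
    (G : ∀ i, SimpleGraph (U i))
    (hsnark : ∀ i, IsSnark (G i)) (hcrit : ∀ i, Critical (G i))
    (x1 x2 w : ∀ i, U i) (n : ∀ i, Fin 3 → U i)
    (hedge : ∀ i, (G i).Adj (x1 i) (x2 i))
    (hd1 : ∀ i, 3 ≤ (G i).dist (w i) (x1 i))
    (hd2 : ∀ i, 3 ≤ (G i).dist (w i) (x2 i))
    (hnbr : ∀ i, (G i).neighborSet (w i) = {n i 0, n i 1, n i 2})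
    (hninj : ∀ i, Function.Injective (n i))
    (hproper : ∀ i, ProperPole (poleFromSnark (G i) (x1 i) (x2 i) (w i) (n i))
        (poleTips (U i)) (poleAttach (x1 i) (x2 i) (n i)))
    (hperfect : ∀ i, PerfectPole (poleFromSnark (G i) (x1 i) (x2 i) (w i) (n i))
        (poleTips (U i)) (poleAttach (x1 i) (x2 i) (n i)))
    (hgood : ∀ i, GoodPoleFrom (G i) (x1 i) (x2 i) (w i)) :
    IsSnark ((glueTTT (fun i => U i ⊕ Fin 5)
        (fun i => poleFromSnark (G i) (x1 i) (x2 i) (w i) (n i))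
        (fun i => poleTips (U i)) (fun i => poleAttach (x1 i) (x2 i) (n i))).induce
        {p | (∀ (i : Fin 3) (j : Fin 5), p ≠ Sum.inl ⟨i, Sum.inr j⟩) ∧
             (∀ i : Fin 3, p ≠ Sum.inl ⟨i, Sum.inl (w i)⟩)}) ∧
    StrictlyCritical ((glueTTT (fun i => U i ⊕ Fin 5)
        (fun i => poleFromSnark (G i) (x1 i) (x2 i) (w i) (n i))
        (fun i => poleTips (U i)) (fun i => poleAttach (x1 i) (x2 i) (n i))).induce
        {p | (∀ (i : Fin 3) (j : Fin 5), p ≠ Sum.inl ⟨i, Sum.inr j⟩) ∧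
             (∀ i : Fin 3, p ≠ Sum.inl ⟨i, Sum.inl (w i)⟩)}) := by
  have hs : ∀ i, PoleSite (G i) (x1 i) (x2 i) (w i) (n i) := fun i =>
    PoleSite.of_dist (hsnark i) (hedge i) (hd1 i) (hd2 i) (hnbr i) (hninj i)
  have hncol := gluedGraph_minus_not_colourable hs hproper
  refine ⟨⟨gluedGraph_connected hs (fun i => (hsnark i).1) hperfect, gluedGraph_cubic hs,
    fun h => hncol (ThreeEdgeColorable.induce h _)⟩,
    gluedGraph_critical hs hperfect hcrit hgood, fun h => hncol (h _ _ fun h' => ?_)⟩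
  have h01 := Sum.inr_injective (Sum.inr_injective (congrArg Subtype.val h'))
  exact absurd h01 (by decide)
end

section
/- Let k ≥ 5 be odd and let J_k be the flower (Isaacs) snark. Let vw be an edge of J_k and u a vertex distinct from v and w and adjacent to neither v nor w. Then, for every labelling of its pendant edges, the (2,3)-pole (J_k − vw) − u is proper and perfect. -/
/-- The flower (Isaacs) snark `J_k`: vertices `a_i = (0, i)`, `b_i = (1, i)`,
`c_i = (2, i)`, `d_i = (3, i)` for `i ∈ ℤ/k`, with edges `a_i b_i`, `a_i c_i`,
`a_i d_i`, `b_i b_{i+1}`, `c_i d_{i+1}`, `d_i c_{i+1}`. -/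
def flowerSnark (k : ℕ) : SimpleGraph (Fin 4 × ZMod k) :=
  SimpleGraph.fromRel (fun p q =>
    ∃ i : ZMod k,
      (p = (0, i) ∧ (q = (1, i) ∨ q = (2, i) ∨ q = (3, i))) ∨
      (p = (1, i) ∧ q = (1, i + 1)) ∨
      (p = (2, i) ∧ q = (3, i + 1)) ∨
      (p = (3, i) ∧ q = (2, i + 1)))

namespace FlowerPole

/-- The flower snark is cut into blocks `a, b, c, d`. Passing to an adjacent block turns the row `x`
into the row `twist x`. -/
def twist : Fin 4 → Fin 4 := ![0, 1, 3, 2]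

/-- The colours of the three edges between two consecutive blocks. -/
abbrev State : Type := Fin 3 → Fin 3

/-- The colours around the vertices of a block. At `a` the three ports lead to `b, c, d`; at the
other vertices the ports lead to `a`, to the next block and to the previous block. -/
abbrev Block : Type := Fin 4 → Fin 3 → Fin 3

def inlet (g : Block) : State := fun j => g j.succ 2

def outlet (cut : Option (Fin 4 × Fin 3)) (g : Block) : State := fun j =>
  if cut = some (twist j.succ, 1) then 1 else g (twist j.succ) 1

/-- `g` colours a block properly except at the vertex `hole`, around which it takes the values `b`.
The two ends of the edge `cut` get the colours `0` and `1`. -/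
def IsBlock (hole : Option (Fin 4)) (cut : Option (Fin 4 × Fin 3)) (b : State) (g : Block) : Prop :=
  (∀ x, if hole = some x then g x = b else g x 0 ≠ g x 1 ∧ g x 0 ≠ g x 2 ∧ g x 1 ≠ g x 2) ∧
  (∀ j : Fin 3, g j.succ 0 = if cut = some (0, j) then 1 else g 0 j) ∧
  (∀ c ∈ cut, g c.1 c.2 = 0)

instance (hole cut b g) : Decidable (IsBlock hole cut b g) := by
  unfold IsBlock; infer_instance

def Step (hole : Option (Fin 4)) (cut : Option (Fin 4 × Fin 3)) (b s t : State) : Prop :=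
  ∃ g, IsBlock hole cut b g ∧ inlet g = s ∧ outlet cut g = t

def mkBlock (hole : Option (Fin 4)) (b p q s : State) : Block := fun x =>
  if hole = some x then b else Fin.cases p (fun j => ![q j, -(q j + s j), s j]) x

/-- Explicit form of `Step none none`. -/
def Plain (s t : State) : Prop :=
  (s 0 ≠ t 0 ∧ s 1 ≠ t 2 ∧ s 2 ≠ t 1) ∧
  s 0 + t 0 ≠ s 1 + t 2 ∧ s 0 + t 0 ≠ s 2 + t 1 ∧ s 1 + t 2 ≠ s 2 + t 1

instance (s t) : Decidable (Plain s t) := by unfold Plain; infer_instance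

/-- The three colours are not all equal. -/
def Live (s : State) : Prop := ¬ (s 0 = s 1 ∧ s 1 = s 2)

instance (s) : Decidable (Live s) := by unfold Live; infer_instance

/-- Invariant of `Plain`. -/
def charge (s : State) : Option (Fin 3) :=
  if s 0 = s 1 then some (s 2) else if s 1 = s 2 then some (s 0)
  else if s 0 = s 2 then some (s 1) else none

/-- Quantity flipped by `Plain`. -/
def phase (s : State) : Bool :=
  if s 0 = s 1 then s 0 = s 2 + 1 else if s 1 = s 2 then s 1 = s 0 + 1
  else if s 0 = s 2 then s 0 = s 1 + 1 else s 1 = s 0 + 1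

/-- The relation of being joined by a long chain of plain steps of parity `p`. -/
def Linked (p : Bool) (s t : State) : Prop :=
  charge t = charge s ∧ phase t = xor p (phase s) ∧ Live s ∧ Live t

instance (p s t) : Decidable (Linked p s t) := by unfold Linked; infer_instance

/-- The relation of being joined by `m` plain steps, for `m` up to parity when `m ≥ 2`. -/
def Bridge (m : ℕ) (s t : State) : Prop :=
  if m = 0 then s = t else if m = 1 then Plain s t else Linked (m % 2 = 1) s t

instance (m s t) : Decidable (Bridge m s t) := by unfold Bridge; infer_instance

def states : List State :=
  [0, 1, 2].flatMap fun x => [0, 1, 2].flatMap fun y => [0, 1, 2].map fun z => ![x, y, z]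

theorem mem_states : ∀ s, s ∈ states := by decide +kernel

set_option maxRecDepth 10000 in
theorem linked_of_plain : ∀ s ∈ states, ∀ t ∈ states, Plain s t → Linked true s t := by
  decide +kernel

set_option maxRecDepth 10000 in
theorem plain_step : ∀ s ∈ states, ∀ t ∈ states, Linked false s t →
  ∃ m ∈ states, Plain s m ∧ Plain m t := by
  decide +kernel

set_option maxRecDepth 10000 in
theorem linked_step : ∀ s ∈ states, ∀ t ∈ states, ∀ p, Linked p s t →
  ∃ m ∈ states, Plain s m ∧ Linked (!p) m t := by
  decide +kernel

/-- The colour triples around the hole that are compatible with the colours `0` and `1` on the two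
ends of the cut edge. -/
def balanced : List State := [![2,2,2],![2,0,0],![2,1,1],![0,2,0],![1,2,1],![0,0,2],![1,1,2]]

def perms : List State := [![0,1,2],![0,2,1],![1,0,2],![1,2,0],![2,0,1],![2,1,0]]

/-- Evaluation of `f` at `x`, written so that the kernel computes `x` only once. -/
def pick {α : Type} (x : Fin 3) (f : Fin 3 → α) : α :=
  if x = 0 then f 0 else if x = 1 then f 1 else f 2

/-- Evaluation of `f` at `s`, written so that the kernel computes `s` only once. -/
def force {α : Type} (s : State) (f : State → α) : α :=
  pick (s 0) fun x => pick (s 1) fun y => pick (s 2) fun z => f ![x, y, z]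

/-- The pairs of states related by `Step hole cut b`. -/
def transitions (hole : Option (Fin 4)) (cut : Option (Fin 4 × Fin 3)) (b : State) :
    List (State × State) :=
  (if hole = some 0 then [b] else perms).flatMap fun p =>
    force (fun j => if cut = some (0, j) then 1 else p j) fun q =>
    [1, 2].flatMap fun x => [1, 2].flatMap fun y => [1, 2].flatMap fun z =>
    force ![q 0 + x, q 1 + y, q 2 + z] fun s =>
      let g := mkBlock hole b p q s
      if IsBlock hole cut b g then
        force (inlet g) fun s => force (outlet cut g) fun t => [(s, t)]
      else []

/-- The possible positions of the cut edge in a block. -/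
def darts : List (Fin 4 × Fin 3) := [(0,0),(0,1),(0,2),(1,1),(2,1),(3,1)]

/-- The cut edge `c` lies `m + 1` blocks after and `n + 1` blocks before the block of the hole `x`,
and has no end next to the hole. -/
def Legal (m n : ℕ) (x : Fin 4) (c : Fin 4 × Fin 3) : Prop :=
  let leaf := if c.1 = 0 then c.2.succ else c.1
  (m = 0 → x ≠ 0 → twist x ≠ leaf) ∧
  (n = 0 → (x ≠ 0 → twist x ≠ leaf) ∧ (c.1 ≠ 0 → x ≠ 0)) ∧
  (n = 1 → c.1 ≠ 0 → x ≠ leaf)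

instance (m n x c) : Decidable (Legal m n x c) := by unfold Legal; infer_instance

set_option maxRecDepth 10000 in
theorem search_far : ∀ c ∈ darts, ∀ x : Fin 4, ∀ b ∈ balanced,
    ∀ mn ∈ [(0, 3), (1, 2), (2, 1), (3, 0), (2, 3), (3, 2)], Legal mn.1 mn.2 x c →
    ∃ e ∈ transitions (some x) none b, ∃ f ∈ transitions none (some c) ![0, 0, 0],
      Bridge mn.1 e.2 f.1 ∧ Bridge mn.2 f.2 e.1 := by
  decide +kernel

set_option maxRecDepth 10000 in
theorem search_near : ∀ x : Fin 4, ∀ c ∈ darts, c.1 ≠ 0 → x ≠ 0 → x ≠ c.1 → ∀ b ∈ balanced,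
    ∃ e ∈ transitions (some x) (some c) b, Linked false e.2 e.1 := by
  decide +kernel

theorem pick_eq {α : Type} (x : Fin 3) (f : Fin 3 → α) : pick x f = f x := by
  fin_cases x <;> rfl

theorem force_eq {α : Type} (s : State) (f : State → α) : force s f = f s := by
  simp only [force, pick_eq]
  congr
  ext i
  fin_cases i <;> rfl

theorem step_of_mem_transitions {hole : Option (Fin 4)} {cut : Option (Fin 4 × Fin 3)}
    {b : State} {e : State × State} (h : e ∈ transitions hole cut b) :
    Step hole cut b e.1 e.2 := by
  simp only [transitions, force_eq, List.mem_flatMap, List.mem_ite_nil_right,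
    List.mem_singleton] at h
  obtain ⟨p, -, x, -, y, -, z, -, hg, rfl⟩ := h
  exact ⟨_, hg, rfl, rfl⟩

theorem Step.of_none {cut : Option (Fin 4 × Fin 3)} {b s t : State} (b' : State)
    (h : Step none cut b s t) : Step none cut b' s t := by
  simpa [Step, IsBlock] using h

theorem step_of_plain {s t : State} (b : State) (h : Plain s t) : Step none none b s t := by
  have key : ∀ x y : Fin 3, x ≠ y → -(x + y) ≠ y ∧ -(x + y) ≠ x ∧ y ≠ x := by decide
  obtain ⟨⟨h0, h1, h2⟩, h3, h4, h5⟩ := h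
  refine ⟨![![-(s 0 + t 0), -(s 1 + t 2), -(s 2 + t 1)], ![-(s 0 + t 0), t 0, s 0],
    ![-(s 1 + t 2), t 2, s 1], ![-(s 2 + t 1), t 1, s 2]], ⟨?_, ?_, by simp⟩, ?_, ?_⟩
  · intro x
    fin_cases x
    · exact ⟨neg_injective.ne h3, neg_injective.ne h4, neg_injective.ne h5⟩
    · exact key _ _ h0
    · exact key _ _ h1
    · exact key _ _ h2
  · intro j
    fin_cases j <;> rfl
  all_goals ext j; fin_cases j <;> rfl

/-- A walk of length `n` whose `r`-th step obeys `R r`. -/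
def Walk (R : ℕ → State → State → Prop) (n : ℕ) (s t : State) : Prop :=
  ∃ S : ℕ → State, S 0 = s ∧ S n = t ∧ ∀ r < n, R r (S r) (S (r + 1))

theorem Walk.nil (R : ℕ → State → State → Prop) (s : State) : Walk R 0 s s :=
  ⟨fun _ => s, rfl, rfl, by simp⟩

theorem Walk.cons {R : ℕ → State → State → Prop} {n : ℕ} {s t u : State}
    (h : R 0 s t) (w : Walk (fun r => R (r + 1)) n t u) : Walk R (n + 1) s u := by
  obtain ⟨S, rfl, rfl, hS⟩ := w
  refine ⟨fun r => Nat.casesOn r s S, rfl, rfl, ?_⟩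
  rintro (_ | r) hr
  · exact h
  · exact hS r (by omega)

theorem Walk.append {R : ℕ → State → State → Prop} {m n : ℕ} {s t u : State}
    (v : Walk R m s t) (w : Walk (fun r => R (r + m)) n t u) : Walk R (n + m) s u := by
  obtain ⟨S, rfl, rfl, hS⟩ := v
  obtain ⟨T, h0, rfl, hT⟩ := w
  refine ⟨fun r => if r < m then S r else T (r - m), ?_, by simp, ?_⟩
  · rcases Nat.eq_zero_or_pos m with rfl | hm
    · simpa using h0
    · simp [hm]
  · intro r hr
    by_cases h : r < m
    · rcases (show r + 1 < m ∨ r + 1 = m by omega) with h' | h'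
      · simpa [h, h'] using hS r h
      · have := hS r h
        rw [h'] at this
        simpa [h, h', h0] using this
    · have h' : ¬ r + 1 < m := by omega
      have := hT (r - m) (by omega)
      simpa [h, h', show r - m + m = r by omega, show r + 1 - m = r - m + 1 by omega] using this

theorem Walk.mono {R R' : ℕ → State → State → Prop} {n : ℕ} {s t : State} (w : Walk R n s t)
    (h : ∀ r < n, ∀ s t, R r s t → R' r s t) : Walk R' n s t := by
  obtain ⟨S, h0, hn, hS⟩ := w
  exact ⟨S, h0, hn, fun r hr => h r hr _ _ (hS r hr)⟩

theorem walk_of_linked {s t : State} (n : ℕ)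
    (h : Linked (decide (n % 2 = 1)) s t) : Walk (fun _ => Plain) (n + 2) s t := by
  induction n generalizing s with
  | zero =>
    obtain ⟨m, -, h1, h2⟩ := plain_step s (mem_states s) t (mem_states t) h
    exact .cons h1 (.cons h2 (.nil _ _))
  | succ n ih =>
    obtain ⟨m, -, h1, h2⟩ := linked_step s (mem_states s) t (mem_states t) _ h
    refine .cons h1 (ih ?_)
    have : (!decide ((n + 1) % 2 = 1)) = decide (n % 2 = 1) := by
      rw [← decide_not, decide_eq_decide]; omega
    rwa [this] at h2

theorem walk_of_bridge {s t : State} (n : ℕ) (h : Bridge n s t) :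
    Walk (fun _ => Plain) n s t := by
  match n, h with
  | 0, h => exact (show s = t from h) ▸ .nil _ _
  | 1, h => exact .cons h (.nil _ _)
  | n + 2, h =>
    refine walk_of_linked n ?_
    simpa [Bridge, Nat.add_mod_right] using h

/-- A representative of the lengths of at least two with the parity of `m`. -/
def shorten (m : ℕ) : ℕ := if m < 2 then m else 2 + m % 2

theorem bridge_shorten (m : ℕ) (s t : State) : Bridge (shorten m) s t ↔ Bridge m s t := by
  unfold Bridge shorten
  split_ifs <;> first | omega | simp_all

theorem shorten_mem {m n : ℕ} (h : 3 ≤ m + n) (h' : Odd (m + n)) :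
    (shorten m, shorten n) ∈ [(0, 3), (1, 2), (2, 1), (3, 0), (2, 3), (3, 2)] := by
  obtain ⟨l, hl⟩ := h'
  simp only [shorten, List.mem_cons, Prod.mk.injEq, List.not_mem_nil, or_false]
  split_ifs <;> omega

/-- The rule for the `r`-th block when the hole is in block `0` and the cut edge in block `e`. -/
def LocalRule (x : Fin 4) (e : ℕ) (c : Fin 4 × Fin 3) (b : State) (r : ℕ) :
    State → State → Prop :=
  Step (if r = 0 then some x else none) (if r = e then some c else none) b

theorem closed_walk_far {m n : ℕ} (h : 3 ≤ m + n) (h' : Odd (m + n)) {x : Fin 4}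
    {c : Fin 4 × Fin 3} (hc : c ∈ darts) (hl : Legal m n x c) {b : State} (hb : b ∈ balanced) :
    ∃ s, Walk (LocalRule x (m + 1) c b) (m + n + 2) s s := by
  have hl' : Legal (shorten m) (shorten n) x c := by
    have e (m i : ℕ) (hi : i < 2) : shorten m = i ↔ m = i := by
      unfold shorten; split_ifs <;> omega
    simpa only [Legal, e _ 0 two_pos, e _ 1 one_lt_two] using hl
  obtain ⟨p, hp, q, hq, h1, h2⟩ := search_far c hc x b hb _ (shorten_mem h h') hl'
  rw [bridge_shorten] at h1 h2
  refine ⟨p.1, ?_⟩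
  have key : Walk (LocalRule x (m + 1) c b) (n + 1 + m + 1) p.1 p.1 := by
    refine .cons (t := p.2) ?_ (.append (t := q.1) ((walk_of_bridge m h1).mono ?_)
      (.cons (t := q.2) ?_ ((walk_of_bridge n h2).mono ?_)))
    · simpa [LocalRule] using step_of_mem_transitions hp
    · intro r hr s t hst
      simpa [LocalRule, hr.ne] using step_of_plain b hst
    · simpa [LocalRule] using (step_of_mem_transitions hq).of_none b
    · intro r hr s t hst
      simpa [LocalRule] using step_of_plain b hst
  convert key using 1
  omega

theorem closed_walk_near {n : ℕ} (h : Even n) (h' : 2 ≤ n) {x : Fin 4}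
    {c : Fin 4 × Fin 3} (hc : c ∈ darts) (h0 : c.1 ≠ 0) (hx : x ≠ 0) (hxc : x ≠ c.1)
    {b : State} (hb : b ∈ balanced) :
    ∃ s, Walk (LocalRule x 0 c b) (n + 1) s s := by
  obtain ⟨p, hp, h1⟩ := search_near x c hc h0 hx hxc b hb
  refine ⟨p.1, .cons (t := p.2) ?_ ((walk_of_bridge n ?_).mono ?_)⟩
  · simpa [LocalRule] using step_of_mem_transitions hp
  · have : n % 2 = 0 := Nat.even_iff.mp h
    simpa [Bridge, this, show n ≠ 0 by omega, show n ≠ 1 by omega] using h1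
  · intro r hr s t hst
    simpa [LocalRule] using step_of_plain b hst

abbrev Vert (k : ℕ) : Type := Fin 4 × ZMod k

abbrev Dart (k : ℕ) : Type := Vert k × Fin 3

/-- The end of the edge at the port `p` of `x`. -/
def nbr {k : ℕ} (x : Vert k) (p : Fin 3) : Vert k :=
  if x.1 = 0 then (p.succ, x.2) else ![(0, x.2), (twist x.1, x.2 + 1), (twist x.1, x.2 - 1)] p

/-- The port at which an edge arrives at its other end. -/
def rev : Fin 4 → Fin 3 → Fin 3 := ![![0, 0, 0], ![0, 2, 1], ![1, 2, 1], ![2, 2, 1]]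

/-- The dart opposite to a given one on the same edge. -/
def mate {k : ℕ} (d : Dart k) : Dart k := (nbr d.1 d.2, rev d.1.1 d.2)

theorem mate_mate {k : ℕ} (d : Dart k) : mate (mate d) = d := by
  obtain ⟨⟨x, i⟩, p⟩ := d
  fin_cases x <;> fin_cases p <;> simp [mate, nbr, rev, twist, Fin.ext_iff]

theorem twist_twist : ∀ x, twist (twist x) = x := by decide

theorem exists_succ_eq : ∀ x : Fin 4, x ≠ 0 → ∃ j : Fin 3, j.succ = x := by decide

theorem twist_ne_zero : ∀ x, x ≠ 0 → twist x ≠ 0 := by decide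

theorem nbr_injective {k : ℕ} (hk : 5 ≤ k) (x : Vert k) : Function.Injective (nbr x) := by
  have h2 : (2 : ZMod k) ≠ 0 := by
    intro h
    have := (ZMod.natCast_eq_zero_iff 2 k).mp (by exact_mod_cast h)
    have := Nat.le_of_dvd two_pos this
    omega
  obtain ⟨x, i⟩ := x
  intro p q h
  by_cases hx : x = 0
  · simpa [nbr, hx] using h
  · have ht := twist_ne_zero x hx
    have e : i + 1 ≠ i - 1 := fun h => h2 (by linear_combination h)
    fin_cases p <;> fin_cases q <;> simp_all [nbr, eq_comm]

theorem flowerSnark_adj {k : ℕ} (hk : 5 ≤ k) (x y : Vert k) :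
    (flowerSnark k).Adj x y ↔ ∃ p, nbr x p = y := by
  have h1 : (1 : ZMod k) ≠ 0 := by
    have : Fact (1 < k) := ⟨by omega⟩
    exact one_ne_zero
  have h1' (i : ZMod k) : i ≠ i - 1 := fun h => h1 (by linear_combination h)
  obtain ⟨x, i⟩ := x
  obtain ⟨y, j⟩ := y
  simp only [flowerSnark, SimpleGraph.fromRel_adj]
  constructor
  · rintro ⟨-, ⟨l, h⟩ | ⟨l, h⟩⟩ <;>
    · simp only [Prod.mk.injEq] at h
      rcases h with ⟨⟨rfl, rfl⟩, ⟨rfl, rfl⟩ | ⟨rfl, rfl⟩ | ⟨rfl, rfl⟩⟩ |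
        ⟨⟨rfl, rfl⟩, rfl, rfl⟩ | ⟨⟨rfl, rfl⟩, rfl, rfl⟩ | ⟨⟨rfl, rfl⟩, rfl, rfl⟩ <;>
      simp [nbr, twist, Fin.exists_fin_succ]
  · rintro ⟨p, h⟩
    fin_cases x <;> fin_cases p <;> simp [nbr, twist] at h <;> obtain ⟨rfl, rfl⟩ := h <;>
      simp [h1, h1']

theorem rev_zero : ∀ p, rev 0 p = 0 := by decide

theorem rev_one : ∀ {x}, x ≠ 0 → rev x 1 = 2 := by decide

theorem val_add_one_eq {k : ℕ} (hk : 5 ≤ k) (i : ZMod k) :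
    (i + 1).val = if i.val + 1 = k then 0 else i.val + 1 := by
  have : NeZero k := ⟨by omega⟩
  have : Fact (1 < k) := ⟨by omega⟩
  have hi := ZMod.val_lt i
  rw [ZMod.val_add, ZMod.val_one]
  split_ifs with h
  · rw [h, Nat.mod_self]
  · exact Nat.mod_eq_of_lt (by omega)

/-- A dart lies on a spoke or leads to the next block, so that its block records the edge. -/
def Canonical {k : ℕ} (d : Dart k) : Prop := d.1.1 = 0 ∨ d.2 = 1

theorem canonical_or_mate {k : ℕ} (d : Dart k) : Canonical d ∨ Canonical (mate d) := by
  obtain ⟨⟨x, i⟩, p⟩ := d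
  fin_cases x <;> fin_cases p <;> simp [Canonical, mate, nbr, rev, twist]

theorem Canonical.mem_darts {k : ℕ} {d : Dart k} (h : Canonical d) : (d.1.1, d.2) ∈ darts := by
  obtain ⟨⟨x, i⟩, p⟩ := d
  have : ∀ (x : Fin 4) (p : Fin 3), x = 0 ∨ p = 1 → (x, p) ∈ darts := by decide
  exact this x p h

/-- A colouring of the darts which is proper away from `u`, takes the values `b` around `u`, and
gives both darts of each edge the same colour, except that `D` and its mate get `a` and `a'`. -/
def IsDartColouring {C : Type} {k : ℕ} (u : Vert k) (D : Dart k) (a a' : C) (b : Fin 3 → C)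
    (h : Dart k → C) : Prop :=
  (∀ x, x ≠ u → Function.Injective fun q => h (x, q)) ∧ (∀ q, h (u, q) = b q) ∧
  h D = a ∧ h (mate D) = a' ∧ ∀ d, d ≠ D → d ≠ mate D → h (mate d) = h d

theorem exists_dartColouring_of_walk {k : ℕ} (hk : 5 ≤ k) {u : Vert k} {D : Dart k}
    (hD : Canonical D) {b : State}
    (hw : ∃ s, Walk (LocalRule u.1 (D.1.2 - u.2).val (D.1.1, D.2) b) k s s) :
    ∃ h, IsDartColouring u D 0 1 b h := by
  have : NeZero k := ⟨by omega⟩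
  obtain ⟨s, S, h0, h1, hS⟩ := hw
  choose! g hg using hS
  let idx (i : ZMod k) : ℕ := (i - u.2).val
  have idx_lt (i : ZMod k) : idx i < k := ZMod.val_lt _
  have idx_inj {i j : ZMod k} (h : idx i = idx j) : i = j := by
    simpa using ZMod.val_injective k h
  have idx_u : idx u.2 = 0 := by simp [idx]
  have S_succ (i : ZMod k) : S (idx (i + 1)) = S (idx i + 1) := by
    have := val_add_one_eq hk (i - u.2)
    rw [show i - u.2 + 1 = i + 1 - u.2 by ring] at this
    simp only [idx, this]
    split_ifs with h
    · rw [h, h0, h1]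
    · rfl
  have hcan : ∀ d, Canonical d → d ≠ D → g (idx (mate d).1.2) (mate d).1.1 (mate d).2 =
      g (idx d.1.2) d.1.1 d.2 := by
    rintro ⟨⟨x, i⟩, p⟩ hd hne
    obtain ⟨⟨-, hsp, -⟩, hin, hout⟩ := hg (idx i) (idx_lt i)
    have hne' : ¬ (idx i = (D.1.2 - u.2).val ∧ D.1.1 = x ∧ D.2 = p) := by
      rintro ⟨hi, rfl, rfl⟩
      exact hne (by rw [idx_inj hi])
    have hcut : (if idx i = (D.1.2 - u.2).val then some (D.1.1, D.2) else none) ≠ some (x, p) := by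
      simpa using hne'
    by_cases hx : x = 0
    · subst hx
      have := hsp p
      rw [if_neg hcut] at this
      simpa [mate, nbr, rev_zero] using this
    · obtain rfl : p = 1 := hd.resolve_left hx
      obtain ⟨j, hj⟩ := exists_succ_eq _ (twist_ne_zero x hx)
      have e1 := congrFun hout j
      have e2 := congrFun (hg (idx (i + 1)) (idx_lt _)).2.1 j
      rw [S_succ, ← e1] at e2
      simp only [inlet, outlet, hj, twist_twist, if_neg hcut] at e2
      simpa [mate, nbr, hx, rev_one hx] using e2
  refine ⟨fun d => g (idx d.1.2) d.1.1 d.2, ?_, ?_, ?_, ?_, ?_⟩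
  · rintro ⟨x, i⟩ hx
    have hx' : ¬ (idx i = 0 ∧ u.1 = x) := by
      rintro ⟨hi, rfl⟩
      exact hx (by rw [idx_inj (hi.trans idx_u.symm)])
    have := (hg (idx i) (idx_lt i)).1.1 x
    rw [if_neg (by simpa using hx')] at this
    obtain ⟨h01, h02, h12⟩ := this
    intro p q hpq
    fin_cases p <;> fin_cases q <;> simp_all
  · intro q
    have := (hg (idx u.2) (idx_lt _)).1.1 u.1
    rw [if_pos (by simp [idx_u])] at this
    exact congrFun this q
  · exact (hg (idx D.1.2) (idx_lt _)).1.2.2 (D.1.1, D.2) (by simp [idx])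
  · obtain ⟨⟨x, i⟩, p⟩ := D
    obtain ⟨⟨-, hsp, -⟩, hin, hout⟩ := hg (idx i) (idx_lt i)
    have hcut : (if idx i = (i - u.2).val then some (x, p) else none) = some (x, p) := by
      simp [idx]
    by_cases hx : x = 0
    · subst hx
      have := hsp p
      rw [if_pos hcut] at this
      simpa [mate, nbr, rev_zero] using this
    · obtain rfl : p = 1 := hD.resolve_left hx
      obtain ⟨j, hj⟩ := exists_succ_eq _ (twist_ne_zero x hx)
      have e1 := congrFun hout j
      have e2 := congrFun (hg (idx (i + 1)) (idx_lt _)).2.1 j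
      rw [S_succ, ← e1] at e2
      simp only [inlet, outlet, hj, twist_twist, if_pos hcut] at e2
      simpa [mate, nbr, hx, rev_one hx] using e2
  · intro d h1 h2
    rcases canonical_or_mate d with hd | hd
    · exact hcan d hd h1
    · have := hcan (mate d) hd (fun h => h2 (by rw [← h, mate_mate]))
      rw [mate_mate] at this
      exact this.symm

/-- The edge of `D` avoids `u` and all neighbours of `u`. -/
def Remote {k : ℕ} (u : Vert k) (D : Dart k) : Prop :=
  (D.1 ≠ u ∧ (mate D).1 ≠ u) ∧ ∀ q, nbr u q ≠ D.1 ∧ nbr u q ≠ (mate D).1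

theorem Remote.legal {k : ℕ} (hk : 5 ≤ k) {u : Vert k} {D : Dart k} (hD : Canonical D)
    (hr : Remote u D) {m n : ℕ} (hm : m + 1 = (D.1.2 - u.2).val) (hn : m + n + 2 = k) :
    Legal m n u.1 (D.1.1, D.2) := by
  have : NeZero k := ⟨by omega⟩
  obtain ⟨x, i⟩ := u
  obtain ⟨⟨y, j⟩, p⟩ := D
  obtain ⟨-, hr⟩ := hr
  simp only at hm
  have hj : j = i + (m + 1) := by
    have := ZMod.natCast_zmod_val (j - i)
    rw [← hm] at this
    push_cast at this
    linear_combination -this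
  have hj' : j = i - (n + 1) := by
    have : ((m + n + 2 : ℕ) : ZMod k) = 0 := by rw [hn, ZMod.natCast_self]
    push_cast at this
    linear_combination hj + this
  have hend (q : Fin 3) (z : Fin 4) (hz : nbr (x, i) q = (z, j)) :
      z ≠ if y = 0 then p.succ else y := by
    rintro rfl
    split_ifs at hz with hy
    · exact (hr q).2 (hz.trans (by simp [mate, nbr, hy]))
    · exact (hr q).1 hz
  have hfar (q : Fin 3) (hy : y ≠ 0) : nbr (x, i) q ≠ (twist y, j + 1) := by
    obtain rfl : p = 1 := hD.resolve_left hy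
    intro h
    exact (hr q).2 (h.trans (by simp [mate, nbr, hy]))
  refine ⟨?_, ?_, ?_⟩
  · rintro rfl hx
    exact hend 1 _ (by simp [nbr, hx, hj])
  · rintro rfl
    refine ⟨fun hx => hend 2 _ (by simp [nbr, hx, hj']), ?_⟩
    rintro hy rfl
    obtain ⟨q, hq⟩ := exists_succ_eq _ (twist_ne_zero y hy)
    exact hfar q hy (by simp [nbr, hq, hj'])
  · rintro rfl hy hxy
    simp only [if_neg hy] at hxy
    have : i - 1 = j + 1 := by rw [hj']; push_cast; ring
    exact hfar 2 hy (by simpa [nbr, hxy, hy] using this)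

theorem Remote.near {k : ℕ} {u : Vert k} {D : Dart k} (hr : Remote u D) (h : D.1.2 = u.2) :
    D.1.1 ≠ 0 ∧ u.1 ≠ 0 ∧ u.1 ≠ D.1.1 := by
  obtain ⟨x, i⟩ := u
  obtain ⟨⟨y, j⟩, p⟩ := D
  obtain ⟨⟨h1, -⟩, hr⟩ := hr
  obtain rfl : j = i := h
  have hne : x ≠ y := by rintro rfl; exact h1 rfl
  refine ⟨?_, ?_, hne⟩
  · rintro rfl
    exact (hr 0).1 (by simp [nbr, hne])
  · rintro rfl
    obtain ⟨q, hq⟩ := exists_succ_eq y hne.symm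
    exact (hr q).1 (by simp [nbr, hq])

theorem exists_dartColouring_of_canonical {k : ℕ} (hk : 5 ≤ k) (hodd : Odd k) {u : Vert k}
    {D : Dart k} (hD : Canonical D) (hr : Remote u D) {b : State} (hb : b ∈ balanced) :
    ∃ h, IsDartColouring u D 0 1 b h := by
  have : NeZero k := ⟨by omega⟩
  have : Fact (1 < k) := ⟨by omega⟩
  refine exists_dartColouring_of_walk hk hD ?_
  obtain ⟨l, hl⟩ := hodd
  rcases Nat.eq_zero_or_pos (D.1.2 - u.2).val with h0 | hpos
  · obtain ⟨hy, hx, hxy⟩ := hr.near (sub_eq_zero.mp ((ZMod.val_eq_zero _).mp h0))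
    have := closed_walk_near (n := k - 1) ⟨l, by omega⟩ (by omega) hD.mem_darts hy hx hxy hb
    rwa [← h0, show k - 1 + 1 = k by omega] at this
  · have hlt := ZMod.val_lt (D.1.2 - u.2)
    obtain ⟨m, hm⟩ : ∃ m, m + 1 = (D.1.2 - u.2).val := ⟨_, Nat.sub_add_cancel hpos⟩
    obtain ⟨n, hn⟩ : ∃ n, m + n + 2 = k := ⟨k - 2 - m, by omega⟩
    have := closed_walk_far (m := m) (n := n) (by omega) ⟨l - 1, by omega⟩ hD.mem_darts
      (hr.legal hk hD hm hn) hb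
    rwa [hm, hn] at this

theorem Remote.swap {k : ℕ} {u : Vert k} {D : Dart k} (hr : Remote u D) :
    Remote u (mate D) := by
  unfold Remote
  rw [mate_mate]
  exact ⟨hr.1.symm, fun q => (hr.2 q).symm⟩

theorem IsDartColouring.swap {C : Type} {k : ℕ} {u : Vert k} {D : Dart k} {a a' : C}
    {b : Fin 3 → C} {h : Dart k → C} (H : IsDartColouring u D a a' b h) :
    IsDartColouring u (mate D) a' a b h := by
  obtain ⟨h1, h2, h3, h4, h5⟩ := H
  refine ⟨h1, h2, h4, by rwa [mate_mate], ?_⟩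
  rw [mate_mate]
  exact fun d hd hd' => h5 d hd' hd

theorem IsDartColouring.map {C C' : Type} {k : ℕ} {u : Vert k} {D : Dart k} {a a' : C}
    {b : Fin 3 → C} {h : Dart k → C} (H : IsDartColouring u D a a' b h) (e : C ≃ C') :
    IsDartColouring u D (e a) (e a') (e ∘ b) (e ∘ h) := by
  obtain ⟨h1, h2, h3, h4, h5⟩ := H
  exact ⟨fun x hx => e.injective.comp (h1 x hx), fun q => congrArg e (h2 q), congrArg e h3,
    congrArg e h4, fun d hd hd' => congrArg e (h5 d hd hd')⟩

theorem mem_balanced : ∀ b : State, (∀ c, Odd ((if 0 = c then 1 else 0) +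
    (if 1 = c then 1 else 0) + ∑ j, if b j = c then 1 else 0)) → b ∈ balanced := by
  decide +kernel

theorem exists_equiv_fin {C : Type} [Fintype C] [DecidableEq C] (hC : Fintype.card C = 3)
    {a a' : C} (h : a ≠ a') : ∃ e : Fin 3 ≃ C, e 0 = a ∧ e 1 = a' := by
  let e := (Fintype.equivFinOfCardEq hC).symm
  refine ⟨((Equiv.swap (e.symm a') 1).trans
    (Equiv.swap (Equiv.swap (e.symm a') 1 (e.symm a)) 0)).symm.trans e, ?_, ?_⟩
  · simp
  · have : Equiv.swap (e.symm a') 1 (e.symm a) ≠ 1 := by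
      rw [Ne, Equiv.swap_apply_eq_iff, Equiv.swap_apply_right]
      exact e.symm.injective.ne h
    simp [Equiv.swap_apply_of_ne_of_ne this.symm (one_ne_zero)]

theorem exists_dartColouring {C : Type} [Fintype C] [DecidableEq C] (hC : Fintype.card C = 3)
    {k : ℕ} (hk : 5 ≤ k) (hodd : Odd k) {u : Vert k} {D : Dart k} (hr : Remote u D)
    {a a' : C} {b : Fin 3 → C} (ha : a ≠ a')
    (hb : ∀ c, Odd ((if a = c then 1 else 0) + (if a' = c then 1 else 0) +
      ∑ j, if b j = c then 1 else 0)) :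
    ∃ h, IsDartColouring u D a a' b h := by
  wlog hD : Canonical D generalizing D a a'
  · obtain ⟨h, H⟩ := this hr.swap ha.symm (fun c => by rw [add_comm (ite _ _ _)]; exact hb c)
      ((canonical_or_mate D).resolve_left hD)
    have := H.swap
    rw [mate_mate] at this
    exact ⟨h, this⟩
  obtain ⟨e, rfl, rfl⟩ := exists_equiv_fin hC ha
  obtain ⟨h, H⟩ := exists_dartColouring_of_canonical hk hodd hD hr
    (mem_balanced (e.symm ∘ b) fun c => by simpa [Equiv.symm_apply_eq] using hb (e c))
  have := H.map e
  rw [← Function.comp_assoc, e.self_comp_symm, Function.id_comp] at this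
  exact ⟨_, this⟩

/-- The tips attached to the neighbours of the deleted vertex. -/
def tip : Fin 3 → Fin 5 := ![2, 3, 4]

theorem tip_cases : ∀ j : Fin 5, j = 0 ∨ j = 1 ∨ ∃ i, tip i = j := by decide

/-- The end of the pole edge at a dart opposite to the base vertex of the dart. -/
def far {k : ℕ} (u : Vert k) (D : Dart k) (σ : Equiv.Perm (Fin 3)) (d : Dart k) :
    Vert k ⊕ Fin 5 :=
  if d = D then .inr 0 else if d = mate D then .inr 1
  else if (mate d).1 = u then .inr (tip (σ (mate d).2)) else .inl (mate d).1

/-- The edge of the pole that corresponds to a dart of the snark. -/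
def dartEdge {k : ℕ} (u : Vert k) (D : Dart k) (σ : Equiv.Perm (Fin 3)) (d : Dart k) :
    Sym2 (Vert k ⊕ Fin 5) :=
  if d.1 = u then s(.inl (mate d).1, far u D σ (mate d)) else s(.inl d.1, far u D σ d)

/-- The pole arises from a remote edge, and `σ` matches its labelling `n` with the ports of `u`. -/
structure PoleLayout {k : ℕ} (u : Vert k) (D : Dart k) (n : Fin 3 → Vert k)
    (σ : Equiv.Perm (Fin 3)) : Prop where
  five_le : 5 ≤ k
  remote : Remote u D
  apply_eq : ∀ q, n (σ q) = nbr u q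

/-- The pole obtained by deleting the edge of `D` and the vertex `u`. -/
abbrev pole {k : ℕ} (u : Vert k) (D : Dart k) (n : Fin 3 → Vert k) :
    SimpleGraph (Vert k ⊕ Fin 5) :=
  poleFromSnark (flowerSnark k) D.1 (mate D).1 u n

theorem pole_adj_inl {k : ℕ} {u : Vert k} {D : Dart k} {n : Fin 3 → Vert k} {x y : Vert k} :
    (pole u D n).Adj (.inl x) (.inl y) ↔
      (flowerSnark k).Adj x y ∧ s(x, y) ≠ s(D.1, (mate D).1) ∧ x ≠ u ∧ y ≠ u := by
  simp only [pole, poleFromSnark, SimpleGraph.fromRel_adj]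
  simp only [ne_eq, Sum.inl.injEq, reduceCtorEq, and_false, or_false]
  constructor
  · rintro ⟨-, ⟨_, _, rfl, rfl, h1, h2, h3, h4⟩ | ⟨_, _, rfl, rfl, h1, h2, h3, h4⟩⟩
    · exact ⟨h1, h2, h3, h4⟩
    · exact ⟨h1.symm, by rwa [Sym2.eq_swap], h4, h3⟩
  · rintro ⟨h1, h2, h3, h4⟩
    exact ⟨h1.ne, .inl ⟨x, y, rfl, rfl, h1, h2, h3, h4⟩⟩

theorem pole_adj_inr {k : ℕ} {u : Vert k} {D : Dart k} {n : Fin 3 → Vert k} {x : Vert k}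
    {j : Fin 5} :
    (pole u D n).Adj (.inl x) (.inr j) ↔ poleAttach D.1 (mate D).1 n j = .inl x := by
  simp only [pole, poleFromSnark, SimpleGraph.fromRel_adj]
  fin_cases j <;> simp [poleAttach, eq_comm]

theorem not_pole_adj_inr {k : ℕ} {u : Vert k} {D : Dart k} {n : Fin 3 → Vert k} {i j : Fin 5} :
    ¬ (pole u D n).Adj (.inr i) (.inr j) := by
  simp [pole, poleFromSnark]

theorem eq_of_nbr_eq {k : ℕ} (hk : 5 ≤ k) {d d' : Dart k} (h : d.1 = d'.1)
    (h' : (mate d).1 = (mate d').1) : d = d' := by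
  obtain ⟨x, p⟩ := d
  obtain ⟨y, q⟩ := d'
  obtain rfl : x = y := h
  exact congrArg (Prod.mk x) (nbr_injective hk x h')

namespace PoleLayout

variable {k : ℕ} {u : Vert k} {D : Dart k} {n : Fin 3 → Vert k} {σ : Equiv.Perm (Fin 3)}

theorem ne_of_fst (L : PoleLayout u D n σ) {d : Dart k} (h : d.1 = u) : d ≠ D ∧ d ≠ mate D :=
  ⟨fun e => L.remote.1.1 (e ▸ h), fun e => L.remote.1.2 (e ▸ h)⟩

theorem ne_of_mate (L : PoleLayout u D n σ) {d : Dart k} (h : (mate d).1 = u) :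
    d ≠ D ∧ d ≠ mate D := by
  refine ⟨fun e => L.remote.1.2 (e ▸ h), fun e => L.remote.1.1 ?_⟩
  rw [e, mate_mate] at h
  exact h

theorem mate_fst_ne (L : PoleLayout u D n σ) (d : Dart k) : (mate d).1 ≠ d.1 :=
  (((flowerSnark_adj L.five_le d.1 (mate d).1).mpr ⟨_, rfl⟩).ne).symm

theorem far_D : far u D σ D = .inr 0 := if_pos rfl

theorem far_mate_D (L : PoleLayout u D n σ) : far u D σ (mate D) = .inr 1 := by
  have : mate D ≠ D := fun h => L.mate_fst_ne D (congrArg Prod.fst h)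
  rw [far, if_neg this, if_pos rfl]

theorem far_mate_u (L : PoleLayout u D n σ) (q : Fin 3) :
    far u D σ (mate (u, q)) = .inr (tip (σ q)) := by
  have h : (mate (mate (u, q))).1 = u := by rw [mate_mate]
  rw [far, if_neg (L.ne_of_mate h).1, if_neg (L.ne_of_mate h).2, if_pos h, mate_mate]

theorem far_eq_inl {d : Dart k} {y : Vert k} :
    far u D σ d = .inl y ↔ d ≠ D ∧ d ≠ mate D ∧ (mate d).1 ≠ u ∧ (mate d).1 = y := by
  unfold far
  split_ifs <;> simp_all

/-- The pendant edges of the pole correspond to the following darts. -/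
def pendant (u : Vert k) (D : Dart k) (σ : Equiv.Perm (Fin 3)) : Fin 5 → Dart k :=
  ![D, mate D, mate (u, σ.symm 0), mate (u, σ.symm 1), mate (u, σ.symm 2)]

theorem pendant_tip (j : Fin 3) : pendant u D σ (tip j) = mate (u, σ.symm j) := by
  fin_cases j <;> rfl

theorem far_eq_inr (L : PoleLayout u D n σ) {d : Dart k} {j : Fin 5} :
    far u D σ d = .inr j ↔ d = pendant u D σ j := by
  constructor
  · intro h
    unfold far at h
    split_ifs at h with h1 h2 h3
    · obtain rfl := Sum.inr_injective h
      exact h1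
    · obtain rfl := Sum.inr_injective h
      exact h2
    · obtain rfl := Sum.inr_injective h
      rw [pendant_tip, σ.symm_apply_apply, ← h3]
      exact (mate_mate d).symm
  · rintro rfl
    obtain rfl | rfl | ⟨i, rfl⟩ := tip_cases j
    · exact far_D
    · exact L.far_mate_D
    · rw [pendant_tip, L.far_mate_u, σ.apply_symm_apply]

theorem pendant_ne (L : PoleLayout u D n σ) (j : Fin 5) : (pendant u D σ j).1 ≠ u := by
  obtain rfl | rfl | ⟨i, rfl⟩ := tip_cases j
  · exact L.remote.1.1
  · exact L.remote.1.2
  · rw [pendant_tip]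
    exact L.mate_fst_ne (u, σ.symm i)

theorem attach_eq (L : PoleLayout u D n σ) (j : Fin 5) :
    poleAttach D.1 (mate D).1 n j = .inl (pendant u D σ j).1 := by
  obtain rfl | rfl | ⟨i, rfl⟩ := tip_cases j
  · rfl
  · rfl
  · have : poleAttach D.1 (mate D).1 n (tip i) = .inl (n i) := by fin_cases i <;> rfl
    rw [this, pendant_tip, ← σ.apply_symm_apply i, L.apply_eq, σ.apply_symm_apply]
    rfl

theorem adj_iff (L : PoleLayout u D n σ) {x : Vert k} {y : Vert k ⊕ Fin 5} :
    (pole u D n).Adj (.inl x) y ↔ x ≠ u ∧ ∃ q, far u D σ (x, q) = y := by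
  rcases y with y | j
  · rw [pole_adj_inl, flowerSnark_adj L.five_le]
    simp only [far_eq_inl]
    constructor
    · rintro ⟨⟨q, rfl⟩, h, hx, hy⟩
      refine ⟨hx, q, ?_, ?_, hy, rfl⟩
      · rintro rfl
        exact h rfl
      · intro e
        refine h ?_
        have e' : mate (x, q) = D := by rw [e, mate_mate]
        rw [Sym2.eq_swap]
        exact congrArg₂ _ (congrArg Prod.fst e') (congrArg Prod.fst e)
    · rintro ⟨hx, q, h1, h2, h3, rfl⟩
      refine ⟨⟨q, rfl⟩, ?_, hx, h3⟩
      rw [Ne, Sym2.eq_iff]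
      rintro (⟨e, e'⟩ | ⟨e, e'⟩)
      · exact h1 (eq_of_nbr_eq L.five_le e e')
      · exact h2 (eq_of_nbr_eq L.five_le e (by rw [mate_mate]; exact e'))
  · rw [pole_adj_inr, L.attach_eq, Sum.inl.injEq]
    simp only [L.far_eq_inr]
    constructor
    · rintro rfl
      exact ⟨L.pendant_ne j, _, rfl⟩
    · rintro ⟨-, q, h⟩
      rw [← h]

theorem dartEdge_of_ne {d : Dart k} (h : d.1 ≠ u) :
    dartEdge u D σ d = s(.inl d.1, far u D σ d) := if_neg h

theorem dartEdge_of_eq (L : PoleLayout u D n σ) {d : Dart k} (h : d.1 = u) :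
    dartEdge u D σ d = dartEdge u D σ (mate d) := by
  have := L.mate_fst_ne d
  rw [dartEdge, if_pos h, dartEdge_of_ne (by rwa [h] at this)]

theorem dartEdge_mate (L : PoleLayout u D n σ) {d : Dart k} (h : d ≠ D) (h' : d ≠ mate D) :
    dartEdge u D σ (mate d) = dartEdge u D σ d := by
  by_cases h1 : d.1 = u
  · exact (L.dartEdge_of_eq h1).symm
  by_cases h2 : (mate d).1 = u
  · rw [L.dartEdge_of_eq h2, mate_mate]
  have e1 : far u D σ d = .inl (mate d).1 := far_eq_inl.mpr ⟨h, h', h2, rfl⟩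
  have e2 : far u D σ (mate d) = .inl d.1 :=
    far_eq_inl.mpr ⟨fun e => h' (by rw [← e, mate_mate]),
      fun e => h (by rw [← mate_mate d, e, mate_mate]), by rwa [mate_mate], by rw [mate_mate]⟩
  rw [dartEdge_of_ne h1, dartEdge_of_ne h2, e1, e2, Sym2.eq_swap]

theorem far_injective (L : PoleLayout u D n σ) {d d' : Dart k} (h : d.1 = d'.1)
    (hf : far u D σ d = far u D σ d') : d = d' := by
  rcases hd : far u D σ d with y | j
  · have hd' := hf.symm.trans hd
    rw [far_eq_inl] at hd hd'
    exact eq_of_nbr_eq L.five_le h (hd.2.2.2.trans hd'.2.2.2.symm)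
  · have hd' := hf.symm.trans hd
    rw [L.far_eq_inr] at hd hd'
    rw [hd, hd']

theorem eq_or_eq_mate (L : PoleLayout u D n σ) {d d' : Dart k} (h : d.1 ≠ u) (h' : d'.1 ≠ u)
    (he : dartEdge u D σ d = dartEdge u D σ d') :
    d' = d ∨ d ≠ D ∧ d ≠ mate D ∧ d' = mate d := by
  rw [dartEdge_of_ne h, dartEdge_of_ne h', Sym2.eq_iff] at he
  rcases he with ⟨e, e'⟩ | ⟨e, e'⟩
  · exact .inl (L.far_injective (Sum.inl_injective e) e').symm
  · rw [far_eq_inl] at e'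
    rw [eq_comm, far_eq_inl] at e
    refine .inr ⟨e'.1, e'.2.1, eq_of_nbr_eq L.five_le e'.2.2.2.symm ?_⟩
    rw [mate_mate]
    exact e.2.2.2

theorem factors (L : PoleLayout u D n σ) {C : Type} {a a' : C} {b : Fin 3 → C} {h : Dart k → C}
    (H : IsDartColouring u D a a' b h) : Function.FactorsThrough h (dartEdge u D σ) := by
  have hm := H.2.2.2.2
  have red (d : Dart k) : ∃ d', d'.1 ≠ u ∧ h d' = h d ∧ dartEdge u D σ d' = dartEdge u D σ d := by
    by_cases hd : d.1 = u
    · obtain ⟨h1, h2⟩ := L.ne_of_fst hd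
      exact ⟨mate d, fun e => L.mate_fst_ne d (e.trans hd.symm), hm d h1 h2,
        L.dartEdge_mate h1 h2⟩
    · exact ⟨d, hd, rfl, rfl⟩
  intro d d' he
  obtain ⟨d₁, h1, h2, h3⟩ := red d
  obtain ⟨d₂, h1', h2', h3'⟩ := red d'
  rw [← h2, ← h2']
  rcases L.eq_or_eq_mate h1 h1' (h3.trans (he.trans h3'.symm)) with rfl | ⟨e1, e2, rfl⟩
  · rfl
  · exact (hm _ e1 e2).symm

theorem exists_dart (L : PoleLayout u D n σ) {e : Sym2 (Vert k ⊕ Fin 5)}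
    (he : e ∈ (pole u D n).edgeSet) {x : Vert k} (hx : .inl x ∈ e) :
    x ≠ u ∧ ∃ q, dartEdge u D σ (x, q) = e := by
  obtain ⟨y, rfl⟩ := hx
  obtain ⟨h, q, rfl⟩ := L.adj_iff.mp he
  exact ⟨h, q, dartEdge_of_ne h⟩

theorem eq_pendant (L : PoleLayout u D n σ) {e : Sym2 (Vert k ⊕ Fin 5)}
    (he : e ∈ (pole u D n).edgeSet) {j : Fin 5} (hj : .inr j ∈ e) :
    e = dartEdge u D σ (pendant u D σ j) := by
  obtain ⟨y, rfl⟩ := hj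
  rcases y with x | i
  · obtain ⟨h, q, hq⟩ := L.adj_iff.mp (SimpleGraph.Adj.symm he)
    replace hq : far u D σ (x, q) = .inr j := hq
    rw [Sym2.eq_swap, ← hq, ← L.far_eq_inr.mp hq]
    exact (dartEdge_of_ne (d := (x, q)) h).symm
  · exact (not_pole_adj_inr he).elim

theorem pendant_edge (L : PoleLayout u D n σ) (j : Fin 5) :
    s(poleAttach D.1 (mate D).1 n j, poleTips (Vert k) j) =
      dartEdge u D σ (pendant u D σ j) := by
  rw [dartEdge_of_ne (L.pendant_ne j), L.far_eq_inr.mpr rfl, L.attach_eq]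
  rfl

theorem dartEdge_mem (L : PoleLayout u D n σ) {d : Dart k} (h : d.1 ≠ u) :
    dartEdge u D σ d ∈ (pole u D n).edgeSet := by
  rw [dartEdge_of_ne h]
  exact L.adj_iff.mpr ⟨h, d.2, rfl⟩

/-- Colourings of the pole are the same as dart colourings. -/
theorem exists_colouring (L : PoleLayout u D n σ) {α : Fin 5 → Kol} {h : Dart k → Kol}
    (H : IsDartColouring u D (α 0) (α 1) (fun q => α (tip (σ q))) h) :
    ∃ f, IsProperEdgeColoring (pole u D n) f ∧
      ∀ j, f s(poleAttach D.1 (mate D).1 n j, poleTips (Vert k) j) = α j := by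
  have hf := (L.factors H).extend_apply (fun _ => α 0)
  obtain ⟨h1, h2, h3, h4, h5⟩ := H
  refine ⟨Function.extend (dartEdge u D σ) h fun _ => α 0, ?_, fun j => ?_⟩
  · rintro e he e' he' hne ⟨x | j, hx, hx'⟩
    · obtain ⟨hxu, q, rfl⟩ := L.exists_dart he hx
      obtain ⟨-, q', rfl⟩ := L.exists_dart he' hx'
      rw [hf, hf]
      exact (h1 x hxu).ne fun hq => hne (by rw [hq])
    · exact (hne ((L.eq_pendant he hx).trans (L.eq_pendant he' hx').symm)).elim
  · rw [L.pendant_edge, hf]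
    obtain rfl | rfl | ⟨i, rfl⟩ := tip_cases j
    · exact h3
    · exact h4
    · have hu := L.ne_of_fst (d := (u, σ.symm i)) rfl
      rw [pendant_tip, h5 _ hu.1 hu.2, h2]
      simp only [σ.apply_symm_apply]

theorem isDartColouring (L : PoleLayout u D n σ) {f : Sym2 (Vert k ⊕ Fin 5) → Kol}
    (hf : IsProperEdgeColoring (pole u D n) f) {α : Fin 5 → Kol}
    (hα : ∀ j, f s(poleAttach D.1 (mate D).1 n j, poleTips (Vert k) j) = α j) :
    IsDartColouring u D (α 0) (α 1) (fun q => α (tip (σ q))) (fun d => f (dartEdge u D σ d)) := by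
  simp only [L.pendant_edge] at hα
  refine ⟨fun x hx q q' hq => ?_, fun q => ?_, hα 0, hα 1,
    fun d h h' => congrArg f (L.dartEdge_mate h h')⟩
  · by_contra hne
    refine hf _ (L.dartEdge_mem (d := (x, q)) hx) _ (L.dartEdge_mem (d := (x, q')) hx)
      (fun he => hne ?_) ⟨.inl x, ?_, ?_⟩ hq
    · rw [dartEdge_of_ne (d := (x, q)) hx, dartEdge_of_ne (d := (x, q')) hx,
        Sym2.congr_right] at he
      exact congrArg Prod.snd (L.far_injective (d := (x, q)) (d' := (x, q')) rfl he)
    · rw [dartEdge_of_ne (d := (x, q)) hx]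
      exact Sym2.mem_mk_left _ _
    · rw [dartEdge_of_ne (d := (x, q')) hx]
      exact Sym2.mem_mk_left _ _
  · have hu := L.ne_of_fst (d := (u, q)) rfl
    have := hα (tip (σ q))
    rwa [pendant_tip, σ.symm_apply_apply, L.dartEdge_mate hu.1 hu.2] at this

end PoleLayout

theorem no_dartColouring {k : ℕ} (hodd : Odd k) (h : Dart k → Fin 3)
    (hinj : ∀ x, Function.Injective fun q => h (x, q)) (hm : ∀ d, h (mate d) = h d) : False := by
  let S (i : ZMod k) : State := fun j => h ((j.succ, i), 2)
  have hS (i : ZMod k) : S (i + 1) = ![h ((1, i), 1), h ((3, i), 1), h ((2, i), 1)] := by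
    ext j
    have h1 := hm ((1, i), 1)
    have h2 := hm ((2, i), 1)
    have h3 := hm ((3, i), 1)
    simp [mate, nbr, rev, twist] at h1 h2 h3
    fin_cases j <;> simp [S, h1, h2, h3]
  have third : ∀ f : Fin 3 → Fin 3, Function.Injective f → f 2 ≠ f 1 ∧ f 2 + f 1 = -f 0 := by
    decide
  have plain (i : ZMod k) : Plain (S i) (S (i + 1)) := by
    have h0 := hm ((0, i), 0)
    have h1 := hm ((0, i), 1)
    have h2 := hm ((0, i), 2)
    simp [mate, nbr, rev] at h0 h1 h2
    have a1 := third _ (hinj (1, i))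
    have a2 := third _ (hinj (2, i))
    have a3 := third _ (hinj (3, i))
    simp only [h0, h1, h2] at a1 a2 a3
    simp only [Plain, hS]
    simp [S, a1, a2, a3, (hinj (0, i)).eq_iff]
  have flip (i : ZMod k) : phase (S (i + 1)) = !phase (S i) := by
    simpa using (linked_of_plain _ (mem_states _) _ (mem_states _) (plain i)).2.1
  have parity (m : ℕ) : phase (S m) = xor (decide (m % 2 = 1)) (phase (S 0)) := by
    induction m with
    | zero => simp
    | succ m ih =>
      rw [Nat.cast_succ, flip, ih]
      rcases Nat.mod_two_eq_zero_or_one m with h | h <;> simp [Nat.add_mod, h]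
  have := parity k
  simp [Nat.odd_iff.mp hodd] at this

theorem sum_eq_zero_of_injective : ∀ c : Fin 3 → Kol, Function.Injective c →
    ∑ q, (c q : ZMod 2 × ZMod 2) = 0 := by
  decide +kernel

theorem injective_of_sum_eq_zero : ∀ c : Fin 3 → Kol,
    ∑ q, (c q : ZMod 2 × ZMod 2) = 0 → Function.Injective c := by
  decide +kernel

theorem add_eq_sum {k : ℕ} (hk : 5 ≤ k) {u : Vert k} {D : Dart k} {a a' : Kol} {b : Fin 3 → Kol}
    {h : Dart k → Kol} (H : IsDartColouring u D a a' b h) :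
    (a + a' : ZMod 2 × ZMod 2) = ∑ q, (b q : ZMod 2 × ZMod 2) := by
  have : NeZero k := ⟨by omega⟩
  have hne (d : Dart k) : mate d ≠ d := fun e =>
    ((flowerSnark_adj hk d.1 (mate d).1).mpr ⟨_, rfl⟩).ne (congrArg Prod.fst e).symm
  have two : ∀ x : ZMod 2 × ZMod 2, x + x = 0 := by decide
  obtain ⟨h1, h2, h3, h4, h5⟩ := H
  have hsum : ∑ d, ((h d : ZMod 2 × ZMod 2) +
      if d = D then (a + a' : ZMod 2 × ZMod 2) else 0) = 0 := by
    refine Finset.sum_involution (fun d _ => mate d) (fun d _ => ?_) (fun d _ _ => hne d)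
      (fun d _ => Finset.mem_univ _) (fun d _ => mate_mate d)
    by_cases e : d = D
    · subst e
      rw [if_pos rfl, if_neg (hne d), h3, h4]
      linear_combination two a + two a'
    by_cases e' : d = mate D
    · subst e'
      rw [mate_mate, if_pos rfl, if_neg (hne D), h3, h4]
      linear_combination two a + two a'
    · rw [if_neg e, if_neg fun e'' => e' (by rw [← e'', mate_mate]), h5 d e e']
      simpa using two (h d)
  rw [Finset.sum_add_distrib, Finset.sum_ite_eq' Finset.univ D, if_pos (Finset.mem_univ _),
    Fintype.sum_prod_type, Finset.sum_eq_single u] at hsum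
  · simp only [h2] at hsum
    linear_combination hsum - two (∑ q, (b q : ZMod 2 × ZMod 2))
  · exact fun x _ hx => sum_eq_zero_of_injective _ (h1 x hx)
  · simp

theorem IsDartColouring.proper {k : ℕ} (hk : 5 ≤ k) (hodd : Odd k) {u : Vert k} {D : Dart k}
    {a a' : Kol} {b : Fin 3 → Kol} {h : Dart k → Kol} (H : IsDartColouring u D a a' b h) :
    (a + a' : ZMod 2 × ZMod 2) ≠ 0 := by
  intro h0
  have hb := injective_of_sum_eq_zero b ((add_eq_sum hk H).symm.trans h0)
  have ha : a = a' := by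
    have : ∀ a a' : Kol, (a + a' : ZMod 2 × ZMod 2) = 0 → a = a' := by decide
    exact this a a' h0
  obtain ⟨h1, h2, h3, h4, h5⟩ := H
  let e : Kol ≃ Fin 3 := Fintype.equivFinOfCardEq (by decide)
  refine no_dartColouring hodd (e ∘ h) (fun x => e.injective.comp ?_) fun d => congrArg e ?_
  · by_cases hx : x = u
    · subst hx
      simpa only [h2] using hb
    · exact h1 x hx
  · by_cases e : d = D
    · rw [e, h3, h4, ha]
    by_cases e' : d = mate D
    · rw [e', mate_mate, h3, h4, ha]
    · exact h5 d e e'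

theorem exists_poleLayout {k : ℕ} (hk : 5 ≤ k) {v w u : Vert k} (hvw : (flowerSnark k).Adj v w)
    (huv : u ≠ v) (huw : u ≠ w) (hav : ¬ (flowerSnark k).Adj u v)
    (haw : ¬ (flowerSnark k).Adj u w) {n : Fin 3 → Vert k}
    (hn : (flowerSnark k).neighborSet u = {n 0, n 1, n 2}) :
    ∃ D σ, PoleLayout u D n σ ∧ D.1 = v ∧ (mate D).1 = w := by
  obtain ⟨p, rfl⟩ := (flowerSnark_adj hk v w).mp hvw
  simp only [flowerSnark_adj hk] at hav haw
  have hmem (q : Fin 3) : ∃ j, n j = nbr u q := by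
    have : nbr u q ∈ (flowerSnark k).neighborSet u := (flowerSnark_adj hk _ _).mpr ⟨q, rfl⟩
    rw [hn] at this
    rcases this with h | h | h
    exacts [⟨0, h.symm⟩, ⟨1, h.symm⟩, ⟨2, h.symm⟩]
  choose σ hσ using hmem
  have hinj : Function.Injective σ := fun q q' h =>
    nbr_injective hk u (by rw [← hσ, ← hσ, h])
  exact ⟨(v, p), .ofBijective σ (Finite.injective_iff_bijective.mp hinj),
    ⟨hk, ⟨⟨huv.symm, huw.symm⟩, fun q => ⟨fun h => hav ⟨q, h⟩, fun h => haw ⟨q, h⟩⟩⟩, hσ⟩,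
    rfl, rfl⟩

end FlowerPole

/-- Let `k ≥ 5` be odd, let `vw` be an edge of the flower snark `J_k`
and let `u` be a vertex distinct from `v, w` and adjacent to neither.  Then, for every
labelling of its pendant edges, the `(2,3)`-pole `(J_k − vw) − u` is proper and
perfect. -/
theorem flowerSnark_pole_proper_perfect
    (k : ℕ) (hk : 5 ≤ k) (hodd : Odd k)
    (v w u : Fin 4 × ZMod k) (hvw : (flowerSnark k).Adj v w)
    (huv : u ≠ v) (huw : u ≠ w)
    (hav : ¬ (flowerSnark k).Adj u v) (haw : ¬ (flowerSnark k).Adj u w)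
    (n : Fin 3 → Fin 4 × ZMod k)
    (hn : (flowerSnark k).neighborSet u = {n 0, n 1, n 2})
    (hninj : Function.Injective n) :
    ProperPole (poleFromSnark (flowerSnark k) v w u n)
        (poleTips (Fin 4 × ZMod k)) (poleAttach v w n) ∧
    PerfectPole (poleFromSnark (flowerSnark k) v w u n)
        (poleTips (Fin 4 × ZMod k)) (poleAttach v w n) := by
  obtain ⟨D, σ, L, rfl, rfl⟩ := FlowerPole.exists_poleLayout hk hvw huv huw hav haw hn
  constructor
  · intro f hf
    have H := L.isDartColouring hf fun _ => rfl
    have h0 := H.proper hk hodd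
    refine ⟨h0, ?_⟩
    rw [FlowerPole.add_eq_sum hk H] at h0
    rw [Equiv.sum_comp σ fun j => (f s(poleAttach D.1 (FlowerPole.mate D).1 n (FlowerPole.tip j),
      poleTips _ (FlowerPole.tip j)) : ZMod 2 × ZMod 2), Fin.sum_univ_three] at h0
    exact h0
  · rintro α hα - hpar
    obtain ⟨h, H⟩ := FlowerPole.exists_dartColouring (C := Kol) (by decide) hk hodd L.remote hα
      (b := fun q => α (FlowerPole.tip (σ q))) fun c => by
        rw [Equiv.sum_comp σ fun j => if α (FlowerPole.tip j) = c then 1 else 0]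
        have hcard : {j | α j = c}.ncard = ∑ j, if α j = c then 1 else 0 := by
          rw [← Finset.card_filter, ← Set.ncard_coe_finset, Finset.coe_filter_univ]
        have := hpar c
        rw [hcard, Fin.sum_univ_five] at this
        rw [Fin.sum_univ_three]
        simp only [add_assoc] at this ⊢
        exact this
    exact L.exists_colouring H
end
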